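/- arXiv:2101.03665 — 3 statements merged into one kernel-verified Lean document; each statement's English description precedes it below -/
import Mathlib

section
/- Let (D, μ) be a probability space and let u_1, …, u_m : D → ℝ be functions forming an orthonormal system in L²(μ) such that Σ_{k=1}^m u_k(x)² ≤ m for every x ∈ D. For X = (x¹,…,xⁿ) ∈ Dⁿ let L(X) be the n×m real matrix with entries (L(X))_{j,k} = u_k(x^j) and H(X) = (1/n)·L(X)^T L(X). Then for every t with 0 < t < 1, the product measure μ^{⊗n} of the set {X ∈ Dⁿ : ‖H(X) − I_m‖ > t} is at most (2n)^{√2} · exp(−n t² / (12 m)), where ‖·‖ is the spectral norm and I_m the m×m identity matrix. -/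
open MeasureTheory Matrix

/-- The spectral norm (largest singular value) of a real matrix, realized as the
operator norm of the associated linear map between Euclidean spaces. -/
noncomputable def specNorm {n m : ℕ} (A : Matrix (Fin n) (Fin m) ℝ) : ℝ :=
  ‖LinearMap.toContinuousLinearMap (Matrix.toEuclideanLin A)‖

section SymmetricMatrices

variable {ι : Type*} [Fintype ι]

/-- Chebyshev's association inequality with nonnegative weights. -/
lemma weighted_sum_mul_sum_le (w f g : ι → ℝ) (hw : ∀ i, 0 ≤ w i) (hfg : Monovary f g) :
    (∑ i, f i * w i) * (∑ i, g i * w i) ≤ (∑ i, w i) * ∑ i, f i * g i * w i := by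
  have key : 0 ≤ ∑ i, ∑ j, w i * w j * ((f i - f j) * (g i - g j)) := by
    refine Finset.sum_nonneg fun i _ => Finset.sum_nonneg fun j _ =>
      mul_nonneg (mul_nonneg (hw i) (hw j)) ?_
    exact monovary_iff_forall_mul_nonneg.mp hfg j i
  have expand : ∑ i, ∑ j, w i * w j * ((f i - f j) * (g i - g j))
      = 2 * ((∑ i, w i) * ∑ i, f i * g i * w i)
        - 2 * ((∑ i, f i * w i) * (∑ i, g i * w i)) := by
    have e1 : ∑ i, ∑ j, w i * w j * ((f i - f j) * (g i - g j))
        = ∑ i, ∑ j, ((f i * g i * w i) * w j + w i * (f j * g j * w j)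
          - (f i * w i) * (g j * w j) - (g i * w i) * (f j * w j)) :=
      Finset.sum_congr rfl fun i _ => Finset.sum_congr rfl fun j _ => by ring
    rw [e1]
    simp only [Finset.sum_add_distrib, Finset.sum_sub_distrib, ← Finset.sum_mul_sum]
    ring
  linarith

lemma trace_mul_vecMulVec_mul (v : ι → ℝ) (A B : Matrix ι ι ℝ) :
    (A * vecMulVec v v * B).trace = v ⬝ᵥ ((B * A) *ᵥ v) := by
  rw [Matrix.trace_mul_comm, ← Matrix.mul_assoc, mul_vecMulVec, trace_vecMulVec, dotProduct_comm]

lemma quadForm_mul_vecMulVec_mul (v : ι → ℝ) (A B : Matrix ι ι ℝ) :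
    v ⬝ᵥ ((A * vecMulVec v v * B) *ᵥ v) = (v ⬝ᵥ (A *ᵥ v)) * (v ⬝ᵥ (B *ᵥ v)) := by
  rw [mul_vecMulVec, vecMulVec_mul, vecMulVec_mulVec, dotProduct_mulVec v B v]
  simp [mul_comm]

lemma posSemidef_add_vecMulVec {S : Matrix ι ι ℝ} (v : ι → ℝ) (hS : S.PosSemidef) :
    (S + vecMulVec v v).PosSemidef :=
  hS.add (by simpa using posSemidef_vecMulVec_self_star v)

variable [DecidableEq ι]

lemma Matrix.IsHermitian.exists_orthogonal_diagonalization {A : Matrix ι ι ℝ}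
    (hA : A.IsHermitian) :
    ∃ (U : Matrix ι ι ℝ) (d : ι → ℝ), U * Uᵀ = 1 ∧ Uᵀ * U = 1 ∧ A = U * diagonal d * Uᵀ := by
  refine ⟨hA.eigenvectorUnitary, hA.eigenvalues, ?_, ?_, ?_⟩
  · have := Unitary.coe_mul_star_self hA.eigenvectorUnitary
    rwa [Unitary.coe_star, star_eq_conjTranspose, conjTranspose_eq_transpose_of_trivial] at this
  · have := Unitary.coe_star_mul_self hA.eigenvectorUnitary
    rwa [star_eq_conjTranspose, conjTranspose_eq_transpose_of_trivial] at this
  · have := hA.spectral_theorem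
    rw [Unitary.conjStarAlgAut_apply, star_eq_conjTranspose,
      conjTranspose_eq_transpose_of_trivial] at this
    exact this

lemma conj_diagonal_pow {U : Matrix ι ι ℝ} (hU : Uᵀ * U = 1) (hU' : U * Uᵀ = 1)
    (d : ι → ℝ) (p : ℕ) :
    (U * diagonal d * Uᵀ) ^ p = U * diagonal (d ^ p) * Uᵀ := by
  induction p with
  | zero => simp [hU']
  | succ p ih =>
    rw [pow_succ, ih, pow_succ, show diagonal (d ^ p * d) = diagonal (d ^ p) * diagonal d from
      (diagonal_mul_diagonal _ _).symm]
    calc U * diagonal (d ^ p) * Uᵀ * (U * diagonal d * Uᵀ)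
        = U * diagonal (d ^ p) * (Uᵀ * U) * diagonal d * Uᵀ := by simp only [Matrix.mul_assoc]
      _ = _ := by rw [hU]; simp only [Matrix.mul_assoc, Matrix.one_mul]

lemma dotProduct_conj_diagonal_mulVec (U : Matrix ι ι ℝ) (d v : ι → ℝ) :
    v ⬝ᵥ ((U * diagonal d * Uᵀ) *ᵥ v) = ∑ i, d i * ((Uᵀ *ᵥ v) i) ^ 2 := by
  rw [← mulVec_mulVec, ← mulVec_mulVec, dotProduct_mulVec, ← mulVec_transpose]
  simp only [dotProduct, mulVec_diagonal]
  exact Finset.sum_congr rfl fun i _ => by ring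

/-- For positive semidefinite `S`, the quadratic forms at `v` of increasing functions of `S`
are positively correlated. -/
lemma quadForm_pow_mul_le {S : Matrix ι ι ℝ} (hS : S.PosSemidef) (v : ι → ℝ) {c : ℝ}
    (hc : 0 ≤ c) (j p : ℕ) :
    (v ⬝ᵥ (S ^ j *ᵥ v)) * (v ⬝ᵥ ((S + c • 1) ^ p *ᵥ v))
      ≤ (v ⬝ᵥ v) * (v ⬝ᵥ ((S ^ j * (S + c • 1) ^ p) *ᵥ v)) := by
  obtain ⟨U, d, h1, h2, h3⟩ := hS.1.exists_orthogonal_diagonalization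
  have hd : ∀ i, 0 ≤ d i := by
    intro i
    have := hS.dotProduct_mulVec_nonneg (U *ᵥ Pi.single i 1)
    rw [star_trivial, h3, dotProduct_conj_diagonal_mulVec, mulVec_mulVec, h2, one_mulVec] at this
    simpa [Pi.single_apply, Finset.sum_ite_eq] using this
  have hSc : S + c • 1 = U * diagonal (fun i => d i + c) * Uᵀ := by
    have : diagonal (fun i => d i + c) = diagonal d + c • (1 : Matrix ι ι ℝ) := by
      rw [← diagonal_one, ← diagonal_smul, diagonal_add]
      congr 1; ext i; simp
    rw [this, Matrix.mul_add, Matrix.add_mul, ← h3]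
    simp [h1]
  have hvv : v ⬝ᵥ v = ∑ i, ((Uᵀ *ᵥ v) i) ^ 2 := by
    have := dotProduct_conj_diagonal_mulVec U (fun _ => 1) v
    simpa [h1] using this
  have hmul : S ^ j * (S + c • 1) ^ p
      = U * diagonal (fun i => d i ^ j * (d i + c) ^ p) * Uᵀ := by
    rw [hSc, h3, conj_diagonal_pow h2 h1, conj_diagonal_pow h2 h1]
    calc U * diagonal (d ^ j) * Uᵀ * (U * diagonal ((fun i => d i + c) ^ p) * Uᵀ)
        = U * diagonal (d ^ j) * (Uᵀ * U) * diagonal ((fun i => d i + c) ^ p) * Uᵀ := by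
          simp only [Matrix.mul_assoc]
      _ = U * (diagonal (d ^ j) * diagonal ((fun i => d i + c) ^ p)) * Uᵀ := by
          rw [h2]; simp only [Matrix.mul_assoc, Matrix.one_mul]
      _ = _ := by rw [diagonal_mul_diagonal]; rfl
  rw [hvv, hmul, hSc, conj_diagonal_pow h2 h1, dotProduct_conj_diagonal_mulVec]
  conv_lhs => rw [h3, conj_diagonal_pow h2 h1, dotProduct_conj_diagonal_mulVec]
  rw [dotProduct_conj_diagonal_mulVec]
  refine weighted_sum_mul_sum_le _ _ _ (fun i => sq_nonneg _) ?_
  rw [monovary_iff_forall_mul_nonneg]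
  intro i k
  simp only [Pi.pow_apply]
  rcases le_total (d i) (d k) with h | h
  · exact mul_nonneg (sub_nonneg.2 (pow_le_pow_left₀ (hd i) h j))
      (sub_nonneg.2 (pow_le_pow_left₀ (by linarith [hd i]) (by linarith) p))
  · exact mul_nonneg_of_nonpos_of_nonpos (sub_nonpos.2 (pow_le_pow_left₀ (hd k) h j))
      (sub_nonpos.2 (pow_le_pow_left₀ (by linarith [hd k]) (by linarith) p))

section RankOneUpdate

variable {S : Matrix ι ι ℝ} (v : ι → ℝ)

lemma quadForm_word_succ (j p : ℕ) :
    v ⬝ᵥ ((S ^ j * (S + vecMulVec v v) ^ (p + 1)) *ᵥ v)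
      = v ⬝ᵥ ((S ^ (j + 1) * (S + vecMulVec v v) ^ p) *ᵥ v)
        + (v ⬝ᵥ (S ^ j *ᵥ v)) * (v ⬝ᵥ ((S + vecMulVec v v) ^ p *ᵥ v)) := by
  rw [← quadForm_mul_vecMulVec_mul, ← dotProduct_add, ← add_mulVec]
  congr 2
  rw [pow_succ' _ p, pow_succ, ← Matrix.mul_assoc, Matrix.mul_add, Matrix.add_mul]

lemma trace_word_succ (hS : S.IsHermitian) (j p : ℕ) :
    (S ^ j * (S + vecMulVec v v) ^ (p + 1)).trace
      = (S ^ (j + 1) * (S + vecMulVec v v) ^ p).trace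
        + v ⬝ᵥ ((S ^ j * (S + vecMulVec v v) ^ p) *ᵥ v) := by
  have hW : (S + vecMulVec v v)ᵀ = S + vecMulVec v v := by
    rw [transpose_add, transpose_vecMulVec]
    rw [← conjTranspose_eq_transpose_of_trivial, hS]
  have hST : Sᵀ = S := by rw [← conjTranspose_eq_transpose_of_trivial]; exact hS
  have hflip : v ⬝ᵥ ((S ^ j * (S + vecMulVec v v) ^ p) *ᵥ v)
      = v ⬝ᵥ (((S + vecMulVec v v) ^ p * S ^ j) *ᵥ v) := by
    rw [dotProduct_mulVec, ← mulVec_transpose, transpose_mul, transpose_pow, transpose_pow, hW, hST,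
      dotProduct_comm]
  rw [hflip, ← trace_mul_vecMulVec_mul, ← trace_add]
  congr 1
  rw [pow_succ' _ p, pow_succ, ← Matrix.mul_assoc, Matrix.mul_add, Matrix.add_mul]

lemma quadForm_pow_nonneg (hS : S.PosSemidef) (j : ℕ) : 0 ≤ v ⬝ᵥ (S ^ j *ᵥ v) := by
  simpa using (hS.pow j).dotProduct_mulVec_nonneg v

lemma quadForm_word_le_succ (hS : S.PosSemidef) (j p : ℕ) :
    v ⬝ᵥ ((S ^ (j + 1) * (S + vecMulVec v v) ^ p) *ᵥ v)
      ≤ v ⬝ᵥ ((S ^ j * (S + vecMulVec v v) ^ (p + 1)) *ᵥ v) := by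
  rw [quadForm_word_succ]
  exact le_add_of_nonneg_right (mul_nonneg (quadForm_pow_nonneg v hS j)
    (quadForm_pow_nonneg v (posSemidef_add_vecMulVec v hS) p))

lemma quadForm_pow_le_word (hS : S.PosSemidef) (j p : ℕ) :
    v ⬝ᵥ (S ^ (j + p) *ᵥ v) ≤ v ⬝ᵥ ((S ^ j * (S + vecMulVec v v) ^ p) *ᵥ v) := by
  induction p generalizing j with
  | zero => simp
  | succ p ih =>
    have := ih (j + 1)
    rw [show j + 1 + p = j + (p + 1) by ring] at this
    exact this.trans (quadForm_word_le_succ v hS j p)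

lemma quadForm_word_le_pow (hS : S.PosSemidef) (j p : ℕ) :
    v ⬝ᵥ ((S ^ j * (S + vecMulVec v v) ^ p) *ᵥ v)
      ≤ v ⬝ᵥ ((S + vecMulVec v v) ^ (j + p) *ᵥ v) := by
  induction j generalizing p with
  | zero => simp
  | succ j ih =>
    have := ih (p + 1)
    rw [show j + (p + 1) = j + 1 + p by ring] at this
    exact (quadForm_word_le_succ v hS j p).trans this

lemma quadForm_word_le_shift (hS : S.PosSemidef) (j p : ℕ) :
    v ⬝ᵥ ((S ^ j * (S + vecMulVec v v) ^ p) *ᵥ v)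
      ≤ v ⬝ᵥ ((S ^ j * (S + (v ⬝ᵥ v) • 1) ^ p) *ᵥ v) := by
  induction p generalizing j with
  | zero => simp
  | succ p ih =>
    have hv : 0 ≤ v ⬝ᵥ v := by simpa using dotProduct_star_self_nonneg v
    have h0 := ih 0
    simp only [pow_zero, Matrix.one_mul] at h0
    have hexp : v ⬝ᵥ ((S ^ j * (S + (v ⬝ᵥ v) • 1) ^ (p + 1)) *ᵥ v)
        = v ⬝ᵥ ((S ^ (j + 1) * (S + (v ⬝ᵥ v) • 1) ^ p) *ᵥ v)
          + (v ⬝ᵥ v) * (v ⬝ᵥ ((S ^ j * (S + (v ⬝ᵥ v) • 1) ^ p) *ᵥ v)) := by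
      rw [pow_succ' _ p, pow_succ, ← Matrix.mul_assoc, Matrix.mul_add, Matrix.add_mul, add_mulVec,
        dotProduct_add]
      simp [smul_mulVec]
    rw [quadForm_word_succ, hexp]
    exact add_le_add (ih (j + 1))
      ((mul_le_mul_of_nonneg_left h0 (quadForm_pow_nonneg v hS j)).trans
        (quadForm_pow_mul_le hS v hv j p))

lemma le_trace_word (hS : S.PosSemidef) (j p : ℕ) :
    (S ^ (j + (p + 1))).trace + (p + 1) * (v ⬝ᵥ (S ^ (j + p) *ᵥ v))
      ≤ (S ^ j * (S + vecMulVec v v) ^ (p + 1)).trace := by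
  induction p generalizing j with
  | zero => rw [trace_word_succ v hS.1]; simp
  | succ p ih =>
    have := ih (j + 1)
    rw [show j + 1 + (p + 1) = j + (p + 1 + 1) by ring, show j + 1 + p = j + (p + 1) by ring] at this
    rw [trace_word_succ v hS.1]
    have h2 := quadForm_pow_le_word v hS j (p + 1)
    push_cast
    linarith

lemma trace_word_le (hS : S.PosSemidef) (j p : ℕ) :
    (S ^ j * (S + vecMulVec v v) ^ (p + 1)).trace
      ≤ (S ^ (j + (p + 1))).trace
        + (p + 1) * (v ⬝ᵥ ((S + vecMulVec v v) ^ (j + p) *ᵥ v)) := by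
  induction p generalizing j with
  | zero =>
    rw [trace_word_succ v hS.1]
    have := quadForm_word_le_pow v hS j 0
    simp at this ⊢
    exact this
  | succ p ih =>
    have := ih (j + 1)
    rw [show j + 1 + (p + 1) = j + (p + 1 + 1) by ring, show j + 1 + p = j + (p + 1) by ring] at this
    rw [trace_word_succ v hS.1]
    have h2 := quadForm_word_le_pow v hS j (p + 1)
    push_cast
    linarith

end RankOneUpdate

section Exponential

lemma hasSum_exp_apply (L : Matrix ι ι ℝ →ₗ[ℝ] ℝ) (A : Matrix ι ι ℝ) :
    HasSum (fun p : ℕ => ((p.factorial : ℝ))⁻¹ * L (A ^ p)) (L (NormedSpace.exp A)) := by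
  let _ : NormedRing (Matrix ι ι ℝ) := Matrix.linftyOpNormedRing
  let _ : NormedAlgebra ℝ (Matrix ι ι ℝ) := Matrix.linftyOpNormedAlgebra
  have h := NormedSpace.exp_series_hasSum_exp' (𝕂 := ℝ) A
  have := h.map L L.continuous_of_finiteDimensional
  simp only [Function.comp_def, map_smul, smul_eq_mul] at this
  exact this

lemma continuous_matrix_exp : Continuous (NormedSpace.exp : Matrix ι ι ℝ → Matrix ι ι ℝ) := by
  let _ : NormedRing (Matrix ι ι ℝ) := Matrix.linftyOpNormedRing
  let _ : NormedAlgebra ℝ (Matrix ι ι ℝ) := Matrix.linftyOpNormedAlgebra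
  let _ : NormedAlgebra ℚ (Matrix ι ι ℝ) := NormedAlgebra.restrictScalars ℚ ℝ (Matrix ι ι ℝ)
  exact NormedSpace.exp_continuous

/-- The quadratic form of a matrix at `v`, as a linear functional of the matrix. -/
def quadFormLinear (v : ι → ℝ) : Matrix ι ι ℝ →ₗ[ℝ] ℝ where
  toFun A := v ⬝ᵥ (A *ᵥ v)
  map_add' A B := by rw [add_mulVec, dotProduct_add]
  map_smul' c A := by rw [smul_mulVec, dotProduct_smul]; rfl

lemma hasSum_quadForm_exp (v : ι → ℝ) (A : Matrix ι ι ℝ) :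
    HasSum (fun p : ℕ => ((p.factorial : ℝ))⁻¹ * (v ⬝ᵥ (A ^ p *ᵥ v)))
      (v ⬝ᵥ (NormedSpace.exp A *ᵥ v)) :=
  hasSum_exp_apply (quadFormLinear v) A

lemma hasSum_trace_exp (A : Matrix ι ι ℝ) :
    HasSum (fun p : ℕ => ((p.factorial : ℝ))⁻¹ * (A ^ p).trace) (NormedSpace.exp A).trace :=
  hasSum_exp_apply (traceLinearMap ι ℝ ℝ) A

lemma hasSum_trace_exp_succ (A : Matrix ι ι ℝ) :
    HasSum (fun p : ℕ => (((p + 1).factorial : ℝ))⁻¹ * (A ^ (p + 1)).trace)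
      ((NormedSpace.exp A).trace - (1 : Matrix ι ι ℝ).trace) := by
  have h := (hasSum_nat_add_iff' 1).2 (hasSum_trace_exp A)
  simpa using h

lemma exp_conj_diagonal {U : Matrix ι ι ℝ} (h1 : U * Uᵀ = 1) (d : ι → ℝ) :
    NormedSpace.exp (U * diagonal d * Uᵀ) = U * diagonal (fun i => Real.exp (d i)) * Uᵀ := by
  have hU : IsUnit U := IsUnit.of_mul_eq_one _ h1
  have hinv : U⁻¹ = Uᵀ := inv_eq_right_inv h1
  have h := exp_conj U (diagonal d) hU
  rw [hinv, exp_diagonal] at h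
  rw [h]
  congr 3
  ext i
  rw [Pi.coe_exp, Real.exp_eq_exp_ℝ]

lemma exp_add_smul_one (A : Matrix ι ι ℝ) (c : ℝ) :
    NormedSpace.exp (A + c • 1) = Real.exp c • NormedSpace.exp A := by
  have h1 : NormedSpace.exp (c • (1 : Matrix ι ι ℝ)) = Real.exp c • 1 := by
    have := exp_conj_diagonal (U := (1 : Matrix ι ι ℝ)) (by simp) (fun _ => c)
    simpa [smul_one_eq_diagonal] using this
  rw [exp_add_of_commute _ _ ((Commute.one_right A).smul_right c), h1]
  simp

lemma Matrix.IsHermitian.exists_add_smul_one_posSemidef {A : Matrix ι ι ℝ} (hA : A.IsHermitian) :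
    ∃ k : ℝ, (A + k • 1).PosSemidef := by
  obtain ⟨U, d, h1, h2, h3⟩ := hA.exists_orthogonal_diagonalization
  refine ⟨∑ i, |d i|, ?_⟩
  have : A + (∑ i, |d i|) • (1 : Matrix ι ι ℝ)
      = U * diagonal (fun j => d j + ∑ i, |d i|) * Uᵀ := by
    rw [show diagonal (fun j => d j + ∑ i, |d i|)
        = diagonal d + (∑ i, |d i|) • (1 : Matrix ι ι ℝ) by
      rw [smul_one_eq_diagonal, diagonal_add], Matrix.mul_add, Matrix.add_mul, ← h3]
    simp [h1]
  rw [this, ← conjTranspose_eq_transpose_of_trivial]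
  refine (PosSemidef.diagonal fun j => ?_).mul_mul_conjTranspose_same U
  have h := Finset.single_le_sum (f := fun i => |d i|) (fun i _ => abs_nonneg _) (Finset.mem_univ j)
  have := neg_abs_le (d j)
  simp only [Pi.zero_apply] at *
  linarith

lemma Matrix.IsHermitian.quadForm_exp_nonneg {S : Matrix ι ι ℝ} (hS : S.IsHermitian)
    (v : ι → ℝ) : 0 ≤ v ⬝ᵥ (NormedSpace.exp S *ᵥ v) := by
  obtain ⟨U, d, h1, h2, h3⟩ := hS.exists_orthogonal_diagonalization
  rw [h3, exp_conj_diagonal h1, dotProduct_conj_diagonal_mulVec]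
  exact Finset.sum_nonneg fun i _ => mul_nonneg (Real.exp_pos _).le (sq_nonneg _)

lemma Matrix.IsHermitian.trace_exp_nonneg {S : Matrix ι ι ℝ} (hS : S.IsHermitian) :
    0 ≤ (NormedSpace.exp S).trace := by
  obtain ⟨U, d, h1, h2, h3⟩ := hS.exists_orthogonal_diagonalization
  rw [h3, exp_conj_diagonal h1, trace_mul_comm, ← Matrix.mul_assoc, h2, Matrix.one_mul,
    trace_diagonal]
  exact Finset.sum_nonneg fun i _ => (Real.exp_pos _).le

variable {S : Matrix ι ι ℝ}

lemma Matrix.IsHermitian.quadForm_exp_add_vecMulVec_le (hS : S.IsHermitian) (v : ι → ℝ) :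
    v ⬝ᵥ (NormedSpace.exp (S + vecMulVec v v) *ᵥ v)
      ≤ Real.exp (v ⬝ᵥ v) * (v ⬝ᵥ (NormedSpace.exp S *ᵥ v)) := by
  obtain ⟨k, hk⟩ := hS.exists_add_smul_one_posSemidef
  have h : v ⬝ᵥ (NormedSpace.exp (S + k • 1 + vecMulVec v v) *ᵥ v)
      ≤ v ⬝ᵥ (NormedSpace.exp (S + k • 1 + (v ⬝ᵥ v) • 1) *ᵥ v) := by
    refine hasSum_le (fun p => ?_) (hasSum_quadForm_exp v _) (hasSum_quadForm_exp v _)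
    refine mul_le_mul_of_nonneg_left ?_ (by positivity)
    simpa using quadForm_word_le_shift v hk 0 p
  rw [add_right_comm, exp_add_smul_one, exp_add_smul_one, exp_add_smul_one, smul_mulVec,
    smul_mulVec, smul_mulVec, dotProduct_smul, dotProduct_smul, dotProduct_smul, smul_eq_mul,
    smul_eq_mul, smul_eq_mul, mul_left_comm] at h
  exact le_of_mul_le_mul_left h (Real.exp_pos k)

lemma Matrix.IsHermitian.trace_exp_add_vecMulVec_le_quadForm (hS : S.IsHermitian) (v : ι → ℝ) :
    (NormedSpace.exp (S + vecMulVec v v)).trace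
      ≤ (NormedSpace.exp S).trace + v ⬝ᵥ (NormedSpace.exp (S + vecMulVec v v) *ᵥ v) := by
  obtain ⟨k, hk⟩ := hS.exists_add_smul_one_posSemidef
  have h := hasSum_le (fun p => ?_) (hasSum_trace_exp_succ (S + k • 1 + vecMulVec v v))
    ((hasSum_trace_exp_succ (S + k • 1)).add
      (hasSum_quadForm_exp v (S + k • 1 + vecMulVec v v)))
  · rw [add_right_comm, exp_add_smul_one, exp_add_smul_one, smul_mulVec, dotProduct_smul,
      trace_smul, trace_smul, smul_eq_mul, smul_eq_mul, smul_eq_mul] at h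
    refine le_of_mul_le_mul_left ?_ (Real.exp_pos k)
    linarith
  · have hw := trace_word_le v hk 0 p
    simp only [pow_zero, Matrix.one_mul, zero_add] at hw
    have hf : (p.factorial : ℝ)⁻¹ = ((p + 1).factorial : ℝ)⁻¹ * (p + 1) := by
      rw [Nat.factorial_succ]; push_cast; field_simp
    rw [hf, mul_assoc, ← mul_add]
    exact mul_le_mul_of_nonneg_left hw (by positivity)

lemma Matrix.IsHermitian.trace_exp_add_quadForm_le (hS : S.IsHermitian) (v : ι → ℝ) :
    (NormedSpace.exp S).trace + v ⬝ᵥ (NormedSpace.exp S *ᵥ v)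
      ≤ (NormedSpace.exp (S + vecMulVec v v)).trace := by
  obtain ⟨k, hk⟩ := hS.exists_add_smul_one_posSemidef
  have h := hasSum_le (fun p => ?_) ((hasSum_trace_exp_succ (S + k • 1)).add
      (hasSum_quadForm_exp v (S + k • 1))) (hasSum_trace_exp_succ (S + k • 1 + vecMulVec v v))
  · rw [add_right_comm, exp_add_smul_one, exp_add_smul_one, smul_mulVec, dotProduct_smul,
      trace_smul, trace_smul, smul_eq_mul, smul_eq_mul, smul_eq_mul] at h
    refine le_of_mul_le_mul_left ?_ (Real.exp_pos k)
    linarith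
  · have hw := le_trace_word v hk 0 p
    simp only [pow_zero, Matrix.one_mul, zero_add] at hw
    have hf : (p.factorial : ℝ)⁻¹ = ((p + 1).factorial : ℝ)⁻¹ * (p + 1) := by
      rw [Nat.factorial_succ]; push_cast; field_simp
    rw [hf, mul_assoc, ← mul_add]
    exact mul_le_mul_of_nonneg_left hw (by positivity)

/-- A Golden-Thompson type inequality for adding a rank-one positive matrix. -/
lemma Matrix.IsHermitian.trace_exp_add_smul_vecMulVec_le (hS : S.IsHermitian) (v : ι → ℝ)
    {θ a : ℝ} (hθ : 0 ≤ θ) (ha : θ * (v ⬝ᵥ v) ≤ a) :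
    (NormedSpace.exp (S + θ • vecMulVec v v)).trace
      ≤ (NormedSpace.exp S).trace
        + θ * Real.exp a * (v ⬝ᵥ (NormedSpace.exp S *ᵥ v)) := by
  set w := √θ • v with hw
  have hsq : √θ * √θ = θ := Real.mul_self_sqrt hθ
  have hvw : vecMulVec w w = θ • vecMulVec v v := by
    ext i j
    simp only [hw, vecMulVec_apply, Matrix.smul_apply, Pi.smul_apply, smul_eq_mul]
    linear_combination (v i * v j) * hsq
  have hww : w ⬝ᵥ w = θ * (v ⬝ᵥ v) := by
    rw [hw, smul_dotProduct, dotProduct_smul, smul_smul, hsq, smul_eq_mul]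
  have hq : w ⬝ᵥ (NormedSpace.exp S *ᵥ w) = θ * (v ⬝ᵥ (NormedSpace.exp S *ᵥ v)) := by
    rw [hw, mulVec_smul, smul_dotProduct, dotProduct_smul, smul_smul, hsq, smul_eq_mul]
  have h1 := hS.trace_exp_add_vecMulVec_le_quadForm w
  have h2 := hS.quadForm_exp_add_vecMulVec_le w
  have h3 : Real.exp (w ⬝ᵥ w) * (w ⬝ᵥ (NormedSpace.exp S *ᵥ w))
      ≤ Real.exp a * (w ⬝ᵥ (NormedSpace.exp S *ᵥ w)) :=
    mul_le_mul_of_nonneg_right (Real.exp_le_exp.2 (hww ▸ ha)) (hS.quadForm_exp_nonneg w)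
  rw [hq] at h3 h2
  rw [hvw] at h1 h2
  linarith

/-- A Golden-Thompson type inequality for subtracting a rank-one positive matrix. -/
lemma Matrix.IsHermitian.trace_exp_sub_smul_vecMulVec_le (hS : S.IsHermitian) (v : ι → ℝ)
    {θ a : ℝ} (hθ : 0 ≤ θ) (ha : θ * (v ⬝ᵥ v) ≤ a) :
    (NormedSpace.exp (S - θ • vecMulVec v v)).trace
      ≤ (NormedSpace.exp S).trace
        - θ * Real.exp (-a) * (v ⬝ᵥ (NormedSpace.exp S *ᵥ v)) := by
  set w := √θ • v with hw
  have hsq : √θ * √θ = θ := Real.mul_self_sqrt hθ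
  have hvw : vecMulVec w w = θ • vecMulVec v v := by
    ext i j
    simp only [hw, vecMulVec_apply, Matrix.smul_apply, Pi.smul_apply, smul_eq_mul]
    linear_combination (v i * v j) * hsq
  have hww : w ⬝ᵥ w = θ * (v ⬝ᵥ v) := by
    rw [hw, smul_dotProduct, dotProduct_smul, smul_smul, hsq, smul_eq_mul]
  have hq : w ⬝ᵥ (NormedSpace.exp S *ᵥ w) = θ * (v ⬝ᵥ (NormedSpace.exp S *ᵥ v)) := by
    rw [hw, mulVec_smul, smul_dotProduct, dotProduct_smul, smul_smul, hsq, smul_eq_mul]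
  have hS' : (S - vecMulVec w w).IsHermitian := by
    refine hS.sub ?_
    rw [IsHermitian, conjTranspose_eq_transpose_of_trivial, transpose_vecMulVec]
  have h1 := hS'.trace_exp_add_quadForm_le w
  have h2 := hS'.quadForm_exp_add_vecMulVec_le w
  rw [sub_add_cancel] at h1 h2
  have h3 : Real.exp (w ⬝ᵥ w) * (w ⬝ᵥ (NormedSpace.exp (S - vecMulVec w w) *ᵥ w))
      ≤ Real.exp a * (w ⬝ᵥ (NormedSpace.exp (S - vecMulVec w w) *ᵥ w)) :=
    mul_le_mul_of_nonneg_right (Real.exp_le_exp.2 (hww ▸ ha)) (hS'.quadForm_exp_nonneg w)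
  have h4 : Real.exp (-a) * (w ⬝ᵥ (NormedSpace.exp S *ᵥ w))
      ≤ w ⬝ᵥ (NormedSpace.exp (S - vecMulVec w w) *ᵥ w) := by
    rw [Real.exp_neg, inv_mul_le_iff₀ (Real.exp_pos a)]
    exact h2.trans h3
  rw [hq] at h4
  rw [← hvw]
  linarith

lemma exp_le_trace_exp_conj_diagonal {U : Matrix ι ι ℝ} (h1 : U * Uᵀ = 1) (h2 : Uᵀ * U = 1)
    (d : ι → ℝ) (a b : ℝ) (i : ι) :
    Real.exp (a * d i + b) ≤ (NormedSpace.exp (a • (U * diagonal d * Uᵀ) + b • 1)).trace := by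
  have h : a • (U * diagonal d * Uᵀ) = U * diagonal (fun i => a * d i) * Uᵀ := by
    rw [show (fun i => a * d i) = a • d from rfl, diagonal_smul]
    simp
  rw [exp_add_smul_one, h, exp_conj_diagonal h1, trace_smul, trace_mul_comm, ← Matrix.mul_assoc,
    h2, Matrix.one_mul, trace_diagonal, smul_eq_mul, Real.exp_add, mul_comm]
  exact mul_le_mul_of_nonneg_left (Finset.single_le_sum (f := fun i => Real.exp (a * d i))
    (fun i _ => (Real.exp_pos _).le) (Finset.mem_univ i)) (Real.exp_pos b).le

end Exponential

end SymmetricMatrices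

lemma specNorm_conj_diagonal_le {m : ℕ} {U : Matrix (Fin m) (Fin m) ℝ} (h1 : U * Uᵀ = 1)
    (h2 : Uᵀ * U = 1) (d : Fin m → ℝ) {t : ℝ} (ht : 0 ≤ t) (hd : ∀ i, |d i| ≤ t) :
    specNorm (U * diagonal d * Uᵀ) ≤ t := by
  refine ContinuousLinearMap.opNorm_le_bound _ ht fun x => ?_
  refine le_of_sq_le_sq ?_ (by positivity)
  set A := U * diagonal d * Uᵀ with hA
  have hAT : Aᵀ = A := by
    rw [hA, transpose_mul, transpose_mul, transpose_transpose, diagonal_transpose, Matrix.mul_assoc]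
  have hAx : ‖LinearMap.toContinuousLinearMap (toEuclideanLin A) x‖ ^ 2
      = x.ofLp ⬝ᵥ ((A ^ 2) *ᵥ x.ofLp) := by
    rw [EuclideanSpace.real_norm_sq_eq, pow_two A, ← mulVec_mulVec, dotProduct_mulVec,
      ← mulVec_transpose, hAT]
    simp [dotProduct, toLpLin_apply, pow_two]
  have hx : ‖x‖ ^ 2 = ∑ i, ((Uᵀ *ᵥ x.ofLp) i) ^ 2 := by
    have := dotProduct_conj_diagonal_mulVec U (fun _ => 1) x.ofLp
    simp only [diagonal_one, Matrix.mul_one, h1, one_mulVec, one_mul] at this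
    rw [← this, EuclideanSpace.real_norm_sq_eq]
    simp [dotProduct, pow_two]
  rw [mul_pow, hAx, hx, hA, conj_diagonal_pow h2 h1, dotProduct_conj_diagonal_mulVec,
    Finset.mul_sum]
  refine Finset.sum_le_sum fun i _ => mul_le_mul_of_nonneg_right ?_ (sq_nonneg _)
  exact sq_le_sq' (abs_le.1 (hd i)).1 (abs_le.1 (hd i)).2

/-- If a symmetric matrix `A` has spectral norm larger than `t`, then one of the traces of
`exp (a • A + b • 1)` with `a = ±s` is large. -/
lemma exp_le_trace_exp_of_lt_specNorm {m : ℕ} {A : Matrix (Fin m) (Fin m) ℝ}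
    (hA : A.IsHermitian) {t s : ℝ} (ht : 0 ≤ t) (hs : 0 ≤ s) (h : t < specNorm A) :
    Real.exp (s * t + s) ≤ (NormedSpace.exp (s • A + s • 1)).trace ∨
      Real.exp (s * t - s) ≤ (NormedSpace.exp (-s • A + (-s) • 1)).trace := by
  obtain ⟨U, d, h1, h2, rfl⟩ := hA.exists_orthogonal_diagonalization
  obtain ⟨i, hi⟩ : ∃ i, t < |d i| := by
    by_contra! hcon
    exact h.not_ge (specNorm_conj_diagonal_le h1 h2 d ht hcon)
  rcases lt_abs.1 hi with hi | hi
  · left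
    refine le_trans (Real.exp_le_exp.2 ?_) (exp_le_trace_exp_conj_diagonal h1 h2 d s s i)
    nlinarith
  · right
    refine le_trans (Real.exp_le_exp.2 ?_) (exp_le_trace_exp_conj_diagonal h1 h2 d (-s) (-s) i)
    nlinarith

section RandomVectors

variable {D : Type*} [MeasurableSpace D] {μ : Measure D} {m : ℕ} {u : Fin m → D → ℝ}

lemma isHermitian_vecMulVec_self (v : Fin m → ℝ) : (vecMulVec v v).IsHermitian := by
  rw [IsHermitian, conjTranspose_eq_transpose_of_trivial, transpose_vecMulVec]

lemma isHermitian_smul_vecMulVec_self (σ : ℝ) (v : Fin m → ℝ) :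
    (σ • vecMulVec v v).IsHermitian := by
  rw [IsHermitian, conjTranspose_smul, isHermitian_vecMulVec_self v, star_trivial]

lemma integrable_mul_of_sum_sq_le [IsFiniteMeasure μ] (humeas : ∀ k, Measurable (u k)) {c : ℝ}
    (hbound : ∀ x, ∑ k, (u k x) ^ 2 ≤ c) (k l : Fin m) :
    Integrable (fun x => u k x * u l x) μ := by
  refine Integrable.of_bound ((humeas k).mul (humeas l)).aestronglyMeasurable c
    (Filter.Eventually.of_forall fun x => ?_)
  have hle : ∀ k, (u k x) ^ 2 ≤ c := fun k =>
    (Finset.single_le_sum (f := fun k => (u k x) ^ 2) (fun i _ => sq_nonneg _)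
      (Finset.mem_univ k)).trans (hbound x)
  rw [Real.norm_eq_abs, abs_le]
  constructor <;> nlinarith [hle k, hle l, sq_nonneg (u k x - u l x), sq_nonneg (u k x + u l x)]

lemma integrable_quadForm (hint : ∀ k l, Integrable (fun x => u k x * u l x) μ)
    (M : Matrix (Fin m) (Fin m) ℝ) :
    Integrable (fun x => (fun k => u k x) ⬝ᵥ (M *ᵥ fun k => u k x)) μ := by
  simp only [dotProduct, mulVec, Finset.mul_sum]
  refine integrable_finsetSum _ fun k _ => integrable_finsetSum _ fun l _ => ?_
  refine ((hint k l).const_mul (M k l)).congr (Filter.Eventually.of_forall fun x => ?_)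
  ring

lemma integral_quadForm (hint : ∀ k l, Integrable (fun x => u k x * u l x) μ)
    (horth : ∀ k l, ∫ x, u k x * u l x ∂μ = if k = l then 1 else 0)
    (M : Matrix (Fin m) (Fin m) ℝ) :
    ∫ x, (fun k => u k x) ⬝ᵥ (M *ᵥ fun k => u k x) ∂μ = M.trace := by
  have h : ∀ x, (fun k => u k x) ⬝ᵥ (M *ᵥ fun k => u k x)
      = ∑ k, ∑ l, M k l * (u k x * u l x) := fun x => by
    simp only [dotProduct, mulVec, Finset.mul_sum]
    exact Finset.sum_congr rfl fun k _ => Finset.sum_congr rfl fun l _ => by ring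
  simp only [h]
  rw [integral_finsetSum _ fun k _ => integrable_finsetSum _ fun l _ =>
    (hint k l).const_mul (M k l)]
  simp only [trace, diag]
  refine Finset.sum_congr rfl fun k _ => ?_
  rw [integral_finsetSum _ fun l _ => (hint k l).const_mul (M k l)]
  simp [integral_const_mul, horth]

/-- Iterating a one-step estimate for the trace exponential over independent samples. -/
lemma lintegral_trace_exp_add_sum_le [IsProbabilityMeasure μ]
    (hint : ∀ k l, Integrable (fun x => u k x * u l x) μ)
    (horth : ∀ k l, ∫ x, u k x * u l x ∂μ = if k = l then 1 else 0) {σ r : ℝ} (hr : 0 ≤ 1 + r)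
    (hstep : ∀ S : Matrix (Fin m) (Fin m) ℝ, S.IsHermitian → ∀ x,
      (NormedSpace.exp (S + σ • vecMulVec (fun k => u k x) (fun k => u k x))).trace
        ≤ (NormedSpace.exp S).trace
          + r * ((fun k => u k x) ⬝ᵥ (NormedSpace.exp S *ᵥ fun k => u k x)))
    (n : ℕ) (S : Matrix (Fin m) (Fin m) ℝ) (hS : S.IsHermitian) :
    ∫⁻ X : Fin n → D, ENNReal.ofReal (NormedSpace.exp
        (S + ∑ j, σ • vecMulVec (fun k => u k (X j)) (fun k => u k (X j)))).trace
        ∂(Measure.pi fun _ => μ)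
      ≤ ENNReal.ofReal ((1 + r) ^ n * (NormedSpace.exp S).trace) := by
  induction n generalizing S with
  | zero => simp
  | succ n ih =>
    rw [← ((measurePreserving_piFinSuccAbove (fun _ : Fin (n + 1) => μ) 0).symm).lintegral_comp_emb
      (MeasurableEquiv.measurableEmbedding _)]
    refine (lintegral_prod_le _).trans ?_
    simp only [MeasurableEquiv.piFinSuccAbove_symm_apply, Fin.insertNthEquiv, Equiv.coe_fn_mk,
      Fin.insertNth_zero', Fin.sum_univ_succ, Fin.cons_zero, Fin.cons_succ, ← add_assoc]
    have hH : ∀ x, (S + σ • vecMulVec (fun k => u k x) (fun k => u k x)).IsHermitian :=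
      fun x => hS.add (isHermitian_smul_vecMulVec_self _ _)
    have hnn : ∀ x, 0 ≤ (NormedSpace.exp S).trace
          + r * ((fun k => u k x) ⬝ᵥ (NormedSpace.exp S *ᵥ fun k => u k x)) :=
      fun x => (hH x).trace_exp_nonneg.trans (hstep S hS x)
    have hquad := integrable_quadForm hint (NormedSpace.exp S)
    calc _ ≤ ∫⁻ x, ENNReal.ofReal ((1 + r) ^ n * (NormedSpace.exp
              (S + σ • vecMulVec (fun k => u k x) (fun k => u k x))).trace) ∂μ :=
          lintegral_mono fun x => ih _ (hH x)
      _ ≤ ∫⁻ x, ENNReal.ofReal ((1 + r) ^ n * ((NormedSpace.exp S).trace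
            + r * ((fun k => u k x) ⬝ᵥ (NormedSpace.exp S *ᵥ fun k => u k x)))) ∂μ :=
          lintegral_mono fun x => ENNReal.ofReal_le_ofReal
            (mul_le_mul_of_nonneg_left (hstep S hS x) (pow_nonneg hr n))
      _ = ENNReal.ofReal (∫ x, (1 + r) ^ n * ((NormedSpace.exp S).trace
            + r * ((fun k => u k x) ⬝ᵥ (NormedSpace.exp S *ᵥ fun k => u k x))) ∂μ) := by
          refine (ofReal_integral_eq_lintegral_ofReal ?_ (Filter.Eventually.of_forall fun x =>
            mul_nonneg (pow_nonneg hr n) (hnn x))).symm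
          exact ((integrable_const _).add (hquad.const_mul r)).const_mul _
      _ = _ := by
          rw [integral_const_mul, integral_add (integrable_const _) (hquad.const_mul r),
            integral_const_mul, integral_quadForm hint horth, integral_const]
          congr 1
          simp
          ring

lemma measurable_trace_exp_sum (humeas : ∀ k, Measurable (u k)) (σ : ℝ) (n : ℕ) :
    Measurable fun X : Fin n → D => (NormedSpace.exp
      (∑ j, σ • vecMulVec (fun k => u k (X j)) (fun k => u k (X j)))).trace := by
  have hcont : Continuous fun f : Fin m → Fin m → ℝ => (NormedSpace.exp (of f)).trace :=
    (continuous_matrix_exp.comp continuous_id).matrix_trace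
  have hmeas : Measurable fun X : Fin n → D => fun (k l : Fin m) =>
      ∑ j, σ * (u k (X j) * u l (X j)) := by
    refine measurable_pi_lambda _ fun k => measurable_pi_lambda _ fun l =>
      Finset.measurable_sum _ fun j _ => ?_
    exact (((humeas k).comp (measurable_pi_apply j)).mul
      ((humeas l).comp (measurable_pi_apply j))).const_mul σ
  convert hcont.measurable.comp hmeas using 1
  ext X
  simp only [Function.comp_apply]
  congr 2
  ext k l
  simp [Matrix.sum_apply, vecMulVec_apply]

/-- Exponential Markov inequality for the trace exponential. -/
lemma measure_exp_le_trace_exp_sum_le [IsProbabilityMeasure μ] (humeas : ∀ k, Measurable (u k))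
    (hint : ∀ k l, Integrable (fun x => u k x * u l x) μ)
    (horth : ∀ k l, ∫ x, u k x * u l x ∂μ = if k = l then 1 else 0) {σ r : ℝ} (hr : 0 ≤ 1 + r)
    (hstep : ∀ S : Matrix (Fin m) (Fin m) ℝ, S.IsHermitian → ∀ x,
      (NormedSpace.exp (S + σ • vecMulVec (fun k => u k x) (fun k => u k x))).trace
        ≤ (NormedSpace.exp S).trace
          + r * ((fun k => u k x) ⬝ᵥ (NormedSpace.exp S *ᵥ fun k => u k x)))
    (n : ℕ) (b : ℝ) :
    (Measure.pi fun _ : Fin n => μ) {X | Real.exp b ≤ (NormedSpace.exp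
        (∑ j, σ • vecMulVec (fun k => u k (X j)) (fun k => u k (X j)))).trace}
      ≤ ENNReal.ofReal (m * Real.exp (n * r - b)) := by
  have hmain := lintegral_trace_exp_add_sum_le hint horth hr hstep n 0 isHermitian_zero
  simp only [zero_add, NormedSpace.exp_zero, trace_one, Fintype.card_fin] at hmain
  have hmarkov := meas_ge_le_lintegral_div (μ := Measure.pi fun _ : Fin n => μ)
    (measurable_trace_exp_sum humeas σ n).ennreal_ofReal.aemeasurable
    (ε := ENNReal.ofReal (Real.exp b)) (by simp [Real.exp_pos]) ENNReal.ofReal_ne_top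
  refine (measure_mono fun X hX => ?_).trans (hmarkov.trans
    ((ENNReal.div_le_div_right hmain _).trans ?_))
  · exact ENNReal.ofReal_le_ofReal hX
  · rw [← ENNReal.ofReal_div_of_pos (Real.exp_pos b)]
    refine ENNReal.ofReal_le_ofReal ?_
    rw [Real.exp_sub, ← mul_div_assoc]
    refine div_le_div_of_nonneg_right ?_ (Real.exp_pos b).le
    rw [mul_comm, Real.exp_nat_mul]
    refine mul_le_mul_of_nonneg_left (pow_le_pow_left₀ hr ?_ n) (Nat.cast_nonneg m)
    linarith [Real.add_one_le_exp r]

end RandomVectors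

/-- concentration of the empirical Gram matrix of a bounded orthonormal
system: for i.i.d. sampling, `μ^{⊗n} {X : ‖H(X) - I‖ > t} ≤ (2n)^√2 exp(-n t²/(12 m))`. -/
theorem stmt1 {D : Type*} [MeasurableSpace D] (μ : Measure D) [IsProbabilityMeasure μ]
    (n m : ℕ) (hn : 1 ≤ n) (hm : 1 ≤ m)
    (u : Fin m → D → ℝ) (humeas : ∀ k, Measurable (u k))
    (horth : ∀ k l : Fin m, ∫ x, u k x * u l x ∂μ = if k = l then 1 else 0)
    (hbound : ∀ x : D, ∑ k : Fin m, (u k x) ^ 2 ≤ (m : ℝ))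
    (t : ℝ) (ht0 : 0 < t) (ht1 : t < 1) :
    (Measure.pi fun _ : Fin n => μ)
        {X : Fin n → D |
          specNorm
              ((1 / (n : ℝ)) •
                  ((Matrix.of fun (j : Fin n) (k : Fin m) => u k (X j))ᵀ *
                    Matrix.of fun (j : Fin n) (k : Fin m) => u k (X j)) - 1) > t}
      ≤ ENNReal.ofReal ((2 * n : ℝ) ^ (Real.sqrt 2) *
          Real.exp (-(n * t ^ 2) / (12 * m))) := by
  have hn0 : (0 : ℝ) < n := by exact_mod_cast hn
  have hm0 : (0 : ℝ) < m := by exact_mod_cast hm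
  have hsqrt : 1 ≤ √2 := Real.one_le_sqrt.2 (by norm_num)
  have h2n : (1 : ℝ) ≤ 2 * n := by
    have : (1 : ℝ) ≤ n := by exact_mod_cast hn
    linarith
  have hpow : (2 * n : ℝ) ≤ (2 * n : ℝ) ^ √2 := Real.self_le_rpow_of_one_le h2n hsqrt
  rcases lt_or_ge n m with hnm | hmn
  · refine prob_le_one.trans (ENNReal.one_le_ofReal.2 ?_)
    have hnm' : (n : ℝ) ≤ m := by exact_mod_cast hnm.le
    have h1 : (2 : ℝ) ≤ (2 * n : ℝ) ^ √2 := le_trans (by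
      have : (1 : ℝ) ≤ n := by exact_mod_cast hn
      linarith) hpow
    have h2 : -(1 / 12 : ℝ) ≤ -(n * t ^ 2) / (12 * m) := by
      rw [le_div_iff₀ (by positivity)]
      nlinarith [mul_le_mul hnm' (show t ^ 2 ≤ 1 by nlinarith) (sq_nonneg t) hm0.le]
    have h3 := Real.add_one_le_exp (-(n * t ^ 2) / (12 * m))
    nlinarith
  have hmn' : (m : ℝ) ≤ n := by exact_mod_cast hmn
  have hm1 : (1 : ℝ) ≤ m := by exact_mod_cast hm
  have hint := integrable_mul_of_sum_sq_le (μ := μ) humeas hbound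
  set θ : ℝ := t / (2 * m) with hθ
  have hθ0 : 0 < θ := by positivity
  have hθm : θ * m = t / 2 := by rw [hθ]; field_simp
  have hnorm : ∀ x, θ * ((fun k => u k x) ⬝ᵥ (fun k => u k x)) ≤ t / 2 := fun x => by
    rw [← hθm]
    refine mul_le_mul_of_nonneg_left ?_ hθ0.le
    simpa [dotProduct, pow_two] using hbound x
  have hexp : -(n * t ^ 2) / (12 * m) = - (n * θ * (t / 6)) := by rw [hθ]; field_simp; ring
  have hup := measure_exp_le_trace_exp_sum_le (σ := θ) humeas hint horth
    (r := θ * Real.exp (t / 2)) (by positivity)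
    (fun S hS x => hS.trace_exp_add_smul_vecMulVec_le _ hθ0.le (hnorm x)) n (θ * n * t + θ * n)
  have hlow := measure_exp_le_trace_exp_sum_le (σ := -θ) humeas hint horth
    (r := -(θ * Real.exp (-(t / 2))))
    (by
      have h1 : Real.exp (-(t / 2)) ≤ 1 := Real.exp_le_one_iff.2 (by linarith)
      have h2 : θ ≤ 1 := by nlinarith
      nlinarith [Real.exp_pos (-(t / 2))])
    (fun S hS x => by
      rw [neg_smul, ← sub_eq_add_neg, neg_mul, ← sub_eq_add_neg]
      exact hS.trace_exp_sub_smul_vecMulVec_le _ hθ0.le (hnorm x)) n (θ * n * t - θ * n)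
  have hup' : (m : ℝ) * Real.exp (n * (θ * Real.exp (t / 2)) - (θ * n * t + θ * n))
      ≤ n * Real.exp (-(n * t ^ 2) / (12 * m)) := by
    refine mul_le_mul hmn' (Real.exp_le_exp.2 ?_) (Real.exp_pos _).le hn0.le
    have h := (abs_le.1 (Real.abs_exp_sub_one_sub_id_le
      (show |t / 2| ≤ 1 by rw [abs_le]; constructor <;> linarith))).2
    rw [hexp]
    have hk : Real.exp (t / 2) - t - 1 ≤ -(t / 6) := by nlinarith
    nlinarith [mul_le_mul_of_nonneg_left hk (mul_pos hn0 hθ0).le]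
  have hlow' : (m : ℝ) * Real.exp (n * (-(θ * Real.exp (-(t / 2)))) - (θ * n * t - θ * n))
      ≤ n * Real.exp (-(n * t ^ 2) / (12 * m)) := by
    refine mul_le_mul hmn' (Real.exp_le_exp.2 ?_) (Real.exp_pos _).le hn0.le
    have h := Real.add_one_le_exp (-(t / 2))
    rw [hexp]
    have hk : -Real.exp (-(t / 2)) - t + 1 ≤ -(t / 6) := by linarith
    nlinarith [mul_le_mul_of_nonneg_left hk (mul_pos hn0 hθ0).le]
  refine (measure_mono fun X hX => ?_).trans ((measure_union_le _ _).trans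
    ((add_le_add hup hlow).trans ?_))
  · set G : Matrix (Fin m) (Fin m) ℝ := (Matrix.of fun (j : Fin n) (k : Fin m) => u k (X j))ᵀ *
      Matrix.of fun (j : Fin n) (k : Fin m) => u k (X j) with hG
    have hsum : ∀ σ : ℝ, ∑ j, σ • vecMulVec (fun k => u k (X j)) (fun k => u k (X j))
        = (σ * n) • ((1 / (n : ℝ)) • G - 1) + (σ * n) • 1 := fun σ => by
      rw [← smul_add, sub_add_cancel, smul_smul, mul_assoc, mul_one_div_cancel hn0.ne', mul_one,
        ← Finset.smul_sum]
      congr 1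
      ext k l
      simp [hG, Matrix.sum_apply, vecMulVec_apply, Matrix.mul_apply]
    have hH : ((1 / (n : ℝ)) • G - 1).IsHermitian := by
      rw [IsHermitian, conjTranspose_eq_transpose_of_trivial, hG]
      simp
    rcases exp_le_trace_exp_of_lt_specNorm hH ht0.le (mul_pos hθ0 hn0).le hX with h | h
    · left
      rw [Set.mem_ofPred_eq, hsum]
      exact h
    · right
      rw [Set.mem_ofPred_eq, hsum, neg_mul]
      exact h
  · rw [← ENNReal.ofReal_add (by positivity) (by positivity)]
    refine ENNReal.ofReal_le_ofReal ((add_le_add hup' hlow').trans ?_)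
    rw [← two_mul, ← mul_assoc]
    exact mul_le_mul_of_nonneg_right hpow (Real.exp_pos _).le
end

section
/- Let (D, μ) be a probability space, δ ∈ (0,1), and n, m ≥ 1 integers with m = ⌊ n / (48(√2·ln(2n) − ln δ)) ⌋. Let u_1, …, u_m : D → ℝ form an orthonormal system in L²(μ) with Σ_{k=1}^m u_k(x)² ≤ m for every x ∈ D, and for X = (x¹,…,xⁿ) ∈ Dⁿ let H(X) = (1/n)·L(X)^T L(X) where L(X) is the n×m matrix with entries u_k(x^j). Then μ^{⊗n}({X ∈ Dⁿ : ‖H(X) − I_m‖ ≤ 1/2}) ≥ 1 − δ. -/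
open MeasureTheory Matrix

section RankOneUpdate

lemma quadForm_rankOne_update {ι : Type*} [Fintype ι] {A B : Matrix ι ι ℝ} {v : ι → ℝ} {c : ℝ}
    (hAB : A = B + vecMulVec v v)
    (hcB : ∀ x, c * (x ⬝ᵥ x) ≤ x ⬝ᵥ B *ᵥ x) (x : ι → ℝ) : c * (x ⬝ᵥ x) ≤ x ⬝ᵥ A *ᵥ x := by
  rw [hAB, add_mulVec, dotProduct_add, vecMulVec_mulVec, dotProduct_smul, dotProduct_comm x v]
  have := hcB x
  simp only [MulOpposite.smul_eq_mul_unop, MulOpposite.unop_op]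
  nlinarith [mul_self_nonneg (v ⬝ᵥ x)]

variable {ι : Type*} [Fintype ι] [DecidableEq ι]

lemma exists_moment_representation {A : Matrix ι ι ℝ} (hA : A.IsHermitian) :
    ∃ (l : ι → ℝ) (b : ι → ι → ℝ), (∀ i, b i ⬝ᵥ b i = 1) ∧ (∀ i, b i ⬝ᵥ A *ᵥ b i = l i) ∧
      (∀ (k : ℕ) (x : ι → ℝ), x ⬝ᵥ (A ^ k) *ᵥ x = ∑ i, (b i ⬝ᵥ x) ^ 2 * l i ^ k) ∧
      ∀ k : ℕ, (A ^ k).trace = ∑ i, l i ^ k := by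
  obtain ⟨U, hU⟩ : ∃ U : Matrix ι ι ℝ, U = (hA.eigenvectorUnitary : Matrix ι ι ℝ) := ⟨_, rfl⟩
  have hUU : Uᵀ * U = 1 := by
    have := Unitary.coe_star_mul_self hA.eigenvectorUnitary
    rwa [← hU, star_eq_conjTranspose, conjTranspose_eq_transpose_of_trivial] at this
  have hpow : ∀ k : ℕ, A ^ k = U * diagonal (fun i => hA.eigenvalues i ^ k) * Uᵀ := by
    intro k
    conv_lhs => rw [hA.spectral_theorem, ← map_pow, Unitary.conjStarAlgAut_apply, diagonal_pow]
    rw [← hU, star_eq_conjTranspose, conjTranspose_eq_transpose_of_trivial]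
    rfl
  have hquad : ∀ (k : ℕ) (x : ι → ℝ),
      x ⬝ᵥ (A ^ k) *ᵥ x = ∑ i, (Uᵀ i ⬝ᵥ x) ^ 2 * hA.eigenvalues i ^ k := by
    intro k x
    rw [hpow k, ← mulVec_mulVec, ← mulVec_mulVec, dotProduct_mulVec, ← mulVec_transpose]
    simp only [dotProduct, mulVec_diagonal]
    refine Finset.sum_congr rfl fun i _ => ?_
    simp only [mulVec, dotProduct]
    ring
  have hb : ∀ i j, Uᵀ i ⬝ᵥ Uᵀ j = if i = j then 1 else 0 := fun i j => by
    have := congrFun (congrFun hUU i) j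
    rwa [mul_apply, one_apply] at this
  refine ⟨hA.eigenvalues, Uᵀ, fun i => by simp [hb], fun i => ?_, hquad, fun k => ?_⟩
  · have := hquad 1 (Uᵀ i)
    simpa [hb] using this
  · rw [hpow, trace_mul_comm, ← Matrix.mul_assoc, hUU, Matrix.one_mul, trace_diagonal]

variable {A B : Matrix ι ι ℝ} {c : ℝ}

lemma quadForm_pow_nonneg_s2 (hA : A.IsHermitian) (hc : 0 ≤ c)
    (hcA : ∀ x, c * (x ⬝ᵥ x) ≤ x ⬝ᵥ A *ᵥ x) (k : ℕ) (x : ι → ℝ) : 0 ≤ x ⬝ᵥ (A ^ k) *ᵥ x := by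
  obtain ⟨l, b, hb, hl, hq, -⟩ := exists_moment_representation hA
  rw [hq]
  refine Finset.sum_nonneg fun i _ => mul_nonneg (sq_nonneg _) (pow_nonneg ?_ _)
  have := hcA (b i)
  rw [hb, hl] at this
  linarith

lemma mul_quadForm_pow_le (hA : A.IsHermitian) (hc : 0 ≤ c)
    (hcA : ∀ x, c * (x ⬝ᵥ x) ≤ x ⬝ᵥ A *ᵥ x) (k : ℕ) (x : ι → ℝ) :
    c * (x ⬝ᵥ (A ^ k) *ᵥ x) ≤ x ⬝ᵥ (A ^ (k + 1)) *ᵥ x := by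
  obtain ⟨l, b, hb, hl, hq, -⟩ := exists_moment_representation hA
  rw [hq, hq, Finset.mul_sum]
  refine Finset.sum_le_sum fun i _ => ?_
  have h := hcA (b i)
  rw [hb, hl] at h
  have : 0 ≤ (b i ⬝ᵥ x) ^ 2 * l i ^ k * (l i - c) :=
    mul_nonneg (mul_nonneg (sq_nonneg _) (pow_nonneg (by linarith) _)) (by linarith)
  rw [pow_succ (l i)]
  linarith

lemma mul_trace_pow_le (hA : A.IsHermitian) (hc : 0 ≤ c)
    (hcA : ∀ x, c * (x ⬝ᵥ x) ≤ x ⬝ᵥ A *ᵥ x) (k : ℕ) :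
    c * (A ^ k).trace ≤ (A ^ (k + 1)).trace := by
  obtain ⟨l, b, hb, hl, -, ht⟩ := exists_moment_representation hA
  rw [ht, ht, Finset.mul_sum]
  refine Finset.sum_le_sum fun i _ => ?_
  have h := hcA (b i)
  rw [hb, hl] at h
  have : 0 ≤ l i ^ k * (l i - c) := mul_nonneg (pow_nonneg (by linarith) _) (by linarith)
  rw [pow_succ (l i)]
  linarith

lemma trace_pow_le_mul {C : ℝ} (hA : A.IsHermitian) (hc : 0 ≤ c)
    (hcA : ∀ x, c * (x ⬝ᵥ x) ≤ x ⬝ᵥ A *ᵥ x) (hAC : ∀ x, x ⬝ᵥ A *ᵥ x ≤ C * (x ⬝ᵥ x)) (k : ℕ) :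
    (A ^ (k + 1)).trace ≤ C * (A ^ k).trace := by
  obtain ⟨l, b, hb, hl, -, ht⟩ := exists_moment_representation hA
  rw [ht, ht, Finset.mul_sum]
  refine Finset.sum_le_sum fun i _ => ?_
  have h := hcA (b i)
  have h' := hAC (b i)
  rw [hb, hl] at h h'
  have : 0 ≤ l i ^ k * (C - l i) := mul_nonneg (pow_nonneg (by linarith) _) (by linarith)
  rw [pow_succ (l i)]
  linarith

lemma trace_pow_nonneg (hA : A.IsHermitian) (hc : 0 ≤ c)
    (hcA : ∀ x, c * (x ⬝ᵥ x) ≤ x ⬝ᵥ A *ᵥ x) (k : ℕ) : 0 ≤ (A ^ k).trace := by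
  obtain ⟨l, b, hb, hl, -, ht⟩ := exists_moment_representation hA
  rw [ht]
  refine Finset.sum_nonneg fun i _ => pow_nonneg ?_ _
  have := hcA (b i)
  rw [hb, hl] at this
  linarith

/-- If the trace of a power of a positive semidefinite matrix is small, then its quadratic form is
bounded accordingly. -/
lemma quadForm_le_of_trace_pow_lt (hA : A.IsHermitian) (hA0 : ∀ x, 0 ≤ x ⬝ᵥ A *ᵥ x) {z : ℝ}
    (k : ℕ) (htr : (A ^ k).trace < z ^ k) (hz : 0 ≤ z) (x : ι → ℝ) :
    x ⬝ᵥ A *ᵥ x ≤ z * (x ⬝ᵥ x) := by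
  obtain ⟨l, b, hb, hl, hq, ht⟩ := exists_moment_representation hA
  have hl0 : ∀ i, 0 ≤ l i := fun i => hl i ▸ hA0 (b i)
  have hlz : ∀ i, l i ≤ z := fun i => by
    by_contra! h
    refine absurd htr (not_lt.2 ?_)
    rw [ht]
    exact (pow_le_pow_left₀ hz h.le k).trans
      (Finset.single_le_sum (f := fun i => l i ^ k) (fun i _ => pow_nonneg (hl0 i) k)
        (Finset.mem_univ i))
  have h1 := hq 1 x
  have h0 := hq 0 x
  simp only [pow_one, pow_zero, mul_one, one_mulVec] at h1 h0
  rw [h1, h0, Finset.mul_sum]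
  refine Finset.sum_le_sum fun i _ => ?_
  rw [mul_comm z]
  exact mul_le_mul_of_nonneg_left (hlz i) (sq_nonneg _)

/-- Chebyshev's correlation inequality for the moments of a positive semidefinite matrix. -/
lemma quadForm_pow_mul_le_s2 (hA : A.IsHermitian) (hA0 : ∀ x, 0 ≤ x ⬝ᵥ A *ᵥ x) (j k : ℕ)
    (x : ι → ℝ) :
    (x ⬝ᵥ (A ^ j) *ᵥ x) * (x ⬝ᵥ (A ^ k) *ᵥ x) ≤ (x ⬝ᵥ x) * (x ⬝ᵥ (A ^ (j + k)) *ᵥ x) := by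
  obtain ⟨l, b, hb, hl, hq, -⟩ := exists_moment_representation hA
  have hl0 : ∀ i, 0 ≤ l i := fun i => hl i ▸ hA0 (b i)
  have h0 := hq 0 x
  simp only [pow_zero, mul_one, one_mulVec] at h0
  rw [hq, hq, hq, h0]
  set w : ι → ℝ := fun i => (b i ⬝ᵥ x) ^ 2 with hw
  have hw0 : ∀ i, 0 ≤ w i := fun i => sq_nonneg _
  have key : 0 ≤ ∑ p, ∑ q, w p * w q * ((l p ^ j - l q ^ j) * (l p ^ k - l q ^ k)) := by
    refine Finset.sum_nonneg fun p _ => Finset.sum_nonneg fun q _ =>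
      mul_nonneg (mul_nonneg (hw0 p) (hw0 q)) ?_
    rcases le_total (l p) (l q) with h | h
    · exact mul_nonneg_of_nonpos_of_nonpos (sub_nonpos.2 (pow_le_pow_left₀ (hl0 p) h _))
        (sub_nonpos.2 (pow_le_pow_left₀ (hl0 p) h _))
    · exact mul_nonneg (sub_nonneg.2 (pow_le_pow_left₀ (hl0 q) h _))
        (sub_nonneg.2 (pow_le_pow_left₀ (hl0 q) h _))
  have expand : ∑ p, ∑ q, w p * w q * ((l p ^ j - l q ^ j) * (l p ^ k - l q ^ k)) =
      2 * ((∑ i, w i) * ∑ i, w i * l i ^ (j + k)) -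
        2 * ((∑ i, w i * l i ^ j) * ∑ i, w i * l i ^ k) := by
    have e1 : ∀ p q, w p * w q * ((l p ^ j - l q ^ j) * (l p ^ k - l q ^ k)) =
        (w p * l p ^ (j + k)) * w q + w p * (w q * l q ^ (j + k))
          - (w p * l p ^ j) * (w q * l q ^ k) - (w p * l p ^ k) * (w q * l q ^ j) := by
      intro p q
      rw [pow_add, pow_add]
      ring
    simp only [e1, Finset.sum_add_distrib, Finset.sum_sub_distrib, ← Finset.mul_sum,
      ← Finset.sum_mul]
    ring
  simp only [hw] at key expand ⊢
  linarith

variable {v : ι → ℝ}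

lemma quadForm_mul_pow_succ (hAB : A = B + vecMulVec v v) (a k : ℕ) :
    v ⬝ᵥ (B ^ a * A ^ (k + 1)) *ᵥ v =
      v ⬝ᵥ (B ^ (a + 1) * A ^ k) *ᵥ v + (v ⬝ᵥ (B ^ a) *ᵥ v) * (v ⬝ᵥ (A ^ k) *ᵥ v) := by
  have : B ^ a * A ^ (k + 1) = B ^ (a + 1) * A ^ k + B ^ a * (vecMulVec v v * A ^ k) := by
    rw [pow_succ' A]
    nth_rw 1 [hAB]
    rw [pow_succ]
    noncomm_ring
  rw [this, add_mulVec, dotProduct_add, ← mulVec_mulVec _ (B ^ a),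
    ← mulVec_mulVec v (vecMulVec v v), vecMulVec_mulVec, mulVec_smul, dotProduct_smul]
  simp [mul_comm]

lemma trace_mul_pow_succ (hA : A.IsHermitian) (hB : B.IsHermitian)
    (hAB : A = B + vecMulVec v v) (a k : ℕ) :
    (B ^ a * A ^ (k + 1)).trace =
      (B ^ (a + 1) * A ^ k).trace + v ⬝ᵥ (B ^ a * A ^ k) *ᵥ v := by
  have : B ^ a * A ^ (k + 1) = B ^ (a + 1) * A ^ k + (B ^ a * vecMulVec v v) * A ^ k := by
    rw [pow_succ' A]
    nth_rw 1 [hAB]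
    rw [pow_succ]
    noncomm_ring
  have hAk : (A ^ k)ᵀ = A ^ k := by
    have := (hA.pow k).eq
    rwa [conjTranspose_eq_transpose_of_trivial] at this
  have hBa : (B ^ a)ᵀ = B ^ a := by
    have := (hB.pow a).eq
    rwa [conjTranspose_eq_transpose_of_trivial] at this
  rw [this, trace_add, mul_vecMulVec, vecMulVec_mul, trace_vecMulVec, ← mulVec_mulVec,
    dotProduct_mulVec v (B ^ a), ← mulVec_transpose, ← mulVec_transpose, hAk, hBa]


lemma quadForm_pow_le_quadForm_mul_pow (hA : A.IsHermitian) (hB : B.IsHermitian)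
    (hAB : A = B + vecMulVec v v) (hc : 0 ≤ c) (hcB : ∀ x, c * (x ⬝ᵥ x) ≤ x ⬝ᵥ B *ᵥ x)
    (a k : ℕ) : v ⬝ᵥ (B ^ (a + k)) *ᵥ v ≤ v ⬝ᵥ (B ^ a * A ^ k) *ᵥ v := by
  induction k generalizing a with
  | zero => simp
  | succ k ih =>
    rw [quadForm_mul_pow_succ hAB]
    have h := ih (a + 1)
    have h1 := quadForm_pow_nonneg_s2 hB hc hcB a v
    have h2 := quadForm_pow_nonneg_s2 hA hc (quadForm_rankOne_update hAB hcB) k v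
    rw [show a + (k + 1) = a + 1 + k by ring]
    nlinarith [mul_nonneg h1 h2]

lemma quadForm_mul_pow_le {K : ℝ} (hA : A.IsHermitian) (hB : B.IsHermitian)
    (hAB : A = B + vecMulVec v v) (hc : 0 < c) (hcB : ∀ x, c * (x ⬝ᵥ x) ≤ x ⬝ᵥ B *ᵥ x)
    (hv : v ⬝ᵥ v ≤ K) (a k : ℕ) :
    v ⬝ᵥ (B ^ a * A ^ k) *ᵥ v ≤
      v ⬝ᵥ (B ^ (a + k)) *ᵥ v + k * (K / c) * (v ⬝ᵥ (A ^ (a + k)) *ᵥ v) := by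
  induction k generalizing a with
  | zero => simp
  | succ k ih =>
    rw [quadForm_mul_pow_succ hAB]
    have h := ih (a + 1)
    have hcA := quadForm_rankOne_update hAB hcB
    have hA0 : ∀ j, 0 ≤ v ⬝ᵥ (A ^ j) *ᵥ v := fun j => quadForm_pow_nonneg_s2 hA hc.le hcA j v
    have h3 : v ⬝ᵥ (B ^ a) *ᵥ v ≤ v ⬝ᵥ (A ^ a) *ᵥ v := by
      simpa using quadForm_pow_le_quadForm_mul_pow hA hB hAB hc.le hcB 0 a
    have hpos : ∀ x, 0 ≤ x ⬝ᵥ A *ᵥ x := fun x => by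
      simpa using quadForm_pow_nonneg_s2 hA hc.le hcA 1 x
    have h4 := quadForm_pow_mul_le_s2 hA hpos a k v
    have h5 := mul_quadForm_pow_le hA hc.le hcA (a + k) v
    have h6 : (v ⬝ᵥ v) * (v ⬝ᵥ (A ^ (a + k)) *ᵥ v) ≤
        K / c * (v ⬝ᵥ (A ^ (a + k + 1)) *ᵥ v) := by
      have hvv : 0 ≤ v ⬝ᵥ v := by simpa using hA0 0
      calc _ ≤ K * (v ⬝ᵥ (A ^ (a + k)) *ᵥ v) := mul_le_mul_of_nonneg_right hv (hA0 _)
        _ = K / c * (c * (v ⬝ᵥ (A ^ (a + k)) *ᵥ v)) := by field_simp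
        _ ≤ _ := mul_le_mul_of_nonneg_left h5 (div_nonneg (hvv.trans hv) hc.le)
    have h7 := mul_le_mul_of_nonneg_right h3 (hA0 k)
    rw [show a + (k + 1) = a + k + 1 by ring]
    rw [show a + 1 + k = a + k + 1 by ring] at h
    push_cast
    linarith

/-- The first order expansion from above of `tr (B + v vᵀ) ^ (p + 1)`. -/
lemma trace_pow_rankOne_update_le {K r : ℝ} (hA : A.IsHermitian) (hB : B.IsHermitian)
    (hAB : A = B + vecMulVec v v) (hc : 0 < c) (hcB : ∀ x, c * (x ⬝ᵥ x) ≤ x ⬝ᵥ B *ᵥ x)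
    (hv : v ⬝ᵥ v ≤ K) (p : ℕ) (hr : p * (K / c) ≤ r) (hr1 : r < 1) :
    (A ^ (p + 1)).trace ≤ (B ^ (p + 1)).trace + (p + 1) / (1 - r) * (v ⬝ᵥ (B ^ p) *ᵥ v) := by
  have hcA := quadForm_rankOne_update hAB hcB
  have hA0 : ∀ j, 0 ≤ v ⬝ᵥ (A ^ j) *ᵥ v := fun j => quadForm_pow_nonneg_s2 hA hc.le hcA j v
  have hK : 0 ≤ K / c := div_nonneg ((by simpa using hA0 0 : 0 ≤ v ⬝ᵥ v).trans hv) hc.le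
  have hα : (1 - r) * (v ⬝ᵥ (A ^ p) *ᵥ v) ≤ v ⬝ᵥ (B ^ p) *ᵥ v := by
    have := quadForm_mul_pow_le hA hB hAB hc hcB hv 0 p
    simp only [pow_zero, Matrix.one_mul, zero_add] at this
    nlinarith [mul_le_mul_of_nonneg_right hr (hA0 p)]
  have hT : ∀ a k : ℕ, a + k = p →
      v ⬝ᵥ (B ^ a * A ^ k) *ᵥ v ≤ (v ⬝ᵥ (B ^ p) *ᵥ v) / (1 - r) := by
    intro a k hak
    have h := quadForm_mul_pow_le hA hB hAB hc hcB hv a k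
    rw [hak] at h
    have hk : (k : ℝ) * (K / c) ≤ r :=
      (mul_le_mul_of_nonneg_right (by exact_mod_cast (by omega : k ≤ p)) hK).trans hr
    have hr0 : 0 ≤ r := le_trans (by positivity) hk
    have h1 := mul_le_mul_of_nonneg_right hk (hA0 p)
    rw [le_div_iff₀ (by linarith)]
    nlinarith
  have hS : ∀ k a : ℕ, a + k = p + 1 →
      (B ^ a * A ^ k).trace ≤ (B ^ (p + 1)).trace + k * ((v ⬝ᵥ (B ^ p) *ᵥ v) / (1 - r)) := by
    intro k
    induction k with
    | zero => intro a ha; simp [← ha]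
    | succ k ih =>
      intro a ha
      rw [trace_mul_pow_succ hA hB hAB]
      have h1 := ih (a + 1) (by omega)
      have h2 := hT a k (by omega)
      push_cast
      linarith
  have := hS (p + 1) 0 (by omega)
  simp only [pow_zero, Matrix.one_mul] at this
  push_cast at this
  calc _ ≤ _ := this
    _ = _ := by ring

/-- The first order expansion from above of `tr (A - v vᵀ) ^ (p + 1)`. -/
lemma trace_pow_rankOne_downdate_le {K r : ℝ} (hA : A.IsHermitian) (hB : B.IsHermitian)
    (hAB : A = B + vecMulVec v v) (hc : 0 < c) (hcB : ∀ x, c * (x ⬝ᵥ x) ≤ x ⬝ᵥ B *ᵥ x)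
    (hv : v ⬝ᵥ v ≤ K) (p : ℕ) (hr : p * (K / c) ≤ r) :
    (B ^ (p + 1)).trace ≤ (A ^ (p + 1)).trace + -((p + 1) * (1 - r)) * (v ⬝ᵥ (A ^ p) *ᵥ v) := by
  have hcA := quadForm_rankOne_update hAB hcB
  have hA0 : ∀ j, 0 ≤ v ⬝ᵥ (A ^ j) *ᵥ v := fun j => quadForm_pow_nonneg_s2 hA hc.le hcA j v
  have hα : (1 - r) * (v ⬝ᵥ (A ^ p) *ᵥ v) ≤ v ⬝ᵥ (B ^ p) *ᵥ v := by
    have := quadForm_mul_pow_le hA hB hAB hc hcB hv 0 p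
    simp only [pow_zero, Matrix.one_mul, zero_add] at this
    nlinarith [mul_le_mul_of_nonneg_right hr (hA0 p)]
  have hS : ∀ k a : ℕ, a + k = p + 1 →
      (B ^ (p + 1)).trace + k * (v ⬝ᵥ (B ^ p) *ᵥ v) ≤ (B ^ a * A ^ k).trace := by
    intro k
    induction k with
    | zero => intro a ha; simp [← ha]
    | succ k ih =>
      intro a ha
      rw [trace_mul_pow_succ hA hB hAB]
      have h1 := ih (a + 1) (by omega)
      have h2 := quadForm_pow_le_quadForm_mul_pow hA hB hAB hc.le hcB a k
      rw [show a + k = p by omega] at h2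
      push_cast
      linarith
  have := hS (p + 1) 0 (by omega)
  simp only [pow_zero, Matrix.one_mul] at this
  push_cast at this
  nlinarith [mul_le_mul_of_nonneg_left hα (by positivity : (0 : ℝ) ≤ p + 1)]

end RankOneUpdate

section Sampling

variable {D : Type*} [MeasurableSpace D]

/-- A multiplicative one-step bound for a functional of an i.i.d. sum iterates. The predicate
`P j B` says that the bound may still be applied `j` times starting from `B`. -/
lemma lintegral_add_sum_le {E : Type*} [AddCommMonoid E] (μ : Measure D) [IsProbabilityMeasure μ]
    (f : D → E) (Φ : E → ENNReal) (P : ℕ → E → Prop) (q : ENNReal)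
    (hmeas : ∀ n B, Measurable fun X : Fin n → D => Φ (B + ∑ j, f (X j)))
    (hP : ∀ n B x, P (n + 1) B → P n (B + f x))
    (hstep : ∀ n B, P (n + 1) B → ∫⁻ x, Φ (B + f x) ∂μ ≤ q * Φ B) (n : ℕ) (B : E) (hB : P n B) :
    ∫⁻ X, Φ (B + ∑ j, f (X j)) ∂(Measure.pi fun _ : Fin n => μ) ≤ q ^ n * Φ B := by
  induction n generalizing B with
  | zero => simp
  | succ n ih =>
    have hmp := (measurePreserving_piFinSuccAbove (fun _ : Fin (n + 1) => μ) 0).symm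
    have hΦ : Measurable fun x => Φ (B + f x) := by
      have h : Measurable fun x : D => fun _ : Fin 1 => x :=
        measurable_pi_lambda _ fun _ => measurable_id
      simpa [Function.comp_def] using (hmeas 1 B).comp h
    rw [← hmp.lintegral_comp (hmeas (n + 1) B), lintegral_prod]
    · calc _ = ∫⁻ x, ∫⁻ X, Φ ((B + f x) + ∑ j, f (X j)) ∂(Measure.pi fun _ : Fin n => μ) ∂μ := by
            simp [Fin.sum_univ_succ, add_assoc, MeasurableEquiv.piFinSuccAbove]
        _ ≤ ∫⁻ x, q ^ n * Φ (B + f x) ∂μ := lintegral_mono fun x => ih _ (hP n B x hB)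
        _ = q ^ n * ∫⁻ x, Φ (B + f x) ∂μ := lintegral_const_mul _ hΦ
        _ ≤ q ^ n * (q * Φ B) := by gcongr; exact hstep n B hB
        _ = _ := by rw [pow_succ, mul_assoc]
    · exact ((hmeas (n + 1) B).comp hmp.measurable).aemeasurable

lemma measurable_trace_pow {α ι : Type*} [MeasurableSpace α] [Fintype ι] [DecidableEq ι]
    {M : α → Matrix ι ι ℝ} (hM : ∀ i j, Measurable fun x => M x i j) (k : ℕ) :
    Measurable fun x => (M x ^ k).trace := by
  have h : ∀ i j, Measurable fun x => (M x ^ k) i j := by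
    induction k with
    | zero => intro i j; simp
    | succ k ih =>
      intro i j
      simp only [pow_succ, mul_apply]
      exact Finset.measurable_sum _ fun l _ => (ih i l).mul (hM l j)
  simp only [trace, diag_apply]
  exact Finset.measurable_sum _ fun i _ => h i i

lemma measurable_trace_add_sum_pow {ι : Type*} [Fintype ι] [DecidableEq ι]
    {f : D → Matrix ι ι ℝ} (hf : ∀ i j, Measurable fun x => f x i j) (k n : ℕ)
    (B : Matrix ι ι ℝ) :
    Measurable fun X : Fin n → D => ((B + ∑ j, f (X j)) ^ k).trace := by
  refine measurable_trace_pow (fun i j => ?_) k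
  simp only [Matrix.add_apply, Matrix.sum_apply]
  exact measurable_const.add (Finset.measurable_sum _ fun l _ =>
    (hf i j).comp (measurable_pi_apply l))

/-- Bounding an expectation by means of a quadratic form in an isotropic random vector. -/
lemma lintegral_ofReal_le_of_le_quadForm {ι : Type*} [Fintype ι] [DecidableEq ι] (μ : Measure D)
    [IsProbabilityMeasure μ] {v : D → ι → ℝ} {K : ℝ} (hv : ∀ k, Measurable fun x => v x k)
    (horth : ∀ k l, ∫ x, v x k * v x l ∂μ = if k = l then 1 else 0)
    (hK : ∀ x, v x ⬝ᵥ v x ≤ K) {F : D → ℝ} {a κ : ℝ} {M : Matrix ι ι ℝ} (hF0 : ∀ x, 0 ≤ F x)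
    (hF : ∀ x, F x ≤ a + κ * (v x ⬝ᵥ M *ᵥ v x)) :
    ∫⁻ x, ENNReal.ofReal (F x) ∂μ ≤ ENNReal.ofReal (a + κ * M.trace) := by
  have hint : ∀ k l, Integrable (fun x => v x k * v x l) μ := fun k l => by
    refine Integrable.of_bound ((hv k).mul (hv l)).aestronglyMeasurable K (.of_forall fun x => ?_)
    have hle : ∀ i, v x i * v x i ≤ K := fun i =>
      (Finset.single_le_sum (f := fun i => v x i * v x i) (fun i _ => mul_self_nonneg _)
        (Finset.mem_univ i)).trans (hK x)
    rw [Real.norm_eq_abs, abs_le]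
    constructor <;>
      nlinarith [hle k, hle l, mul_self_nonneg (v x k - v x l), mul_self_nonneg (v x k + v x l)]
  have hquad : ∀ x, v x ⬝ᵥ M *ᵥ v x = ∑ k, ∑ l, M k l * (v x k * v x l) := fun x => by
    simp only [dotProduct, mulVec, Finset.mul_sum]
    exact Finset.sum_congr rfl fun k _ => Finset.sum_congr rfl fun l _ => by ring
  have hintq : Integrable (fun x => v x ⬝ᵥ M *ᵥ v x) μ := by
    simp only [hquad]
    exact integrable_finsetSum _ fun k _ => integrable_finsetSum _ fun l _ =>
      (hint k l).const_mul _
  have hE : ∫ x, v x ⬝ᵥ M *ᵥ v x ∂μ = M.trace := by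
    simp only [hquad]
    have h : ∀ k, ∫ x, ∑ l, M k l * (v x k * v x l) ∂μ = M k k := fun k => by
      rw [integral_finsetSum _ fun l _ => (hint k l).const_mul (M k l)]
      simp [integral_const_mul, horth]
    rw [integral_finsetSum]
    · exact Finset.sum_congr rfl fun k _ => h k
    · exact fun k _ => integrable_finsetSum _ fun l _ => (hint k l).const_mul (M k l)
  have hint' : Integrable (fun x => a + κ * (v x ⬝ᵥ M *ᵥ v x)) μ :=
    (integrable_const a).add (hintq.const_mul κ)
  calc _ ≤ ∫⁻ x, ENNReal.ofReal (a + κ * (v x ⬝ᵥ M *ᵥ v x)) ∂μ :=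
        lintegral_mono fun x => ENNReal.ofReal_le_ofReal (hF x)
    _ = ENNReal.ofReal (∫ x, a + κ * (v x ⬝ᵥ M *ᵥ v x) ∂μ) :=
        (ofReal_integral_eq_lintegral_ofReal hint'
          (.of_forall fun x => (hF0 x).trans (hF x))).symm
    _ = _ := by
        rw [integral_add (integrable_const a) (hintq.const_mul κ), integral_const_mul, hE]
        simp

/-- Markov's inequality for the trace of a power. -/
lemma measure_le_trace_pow_le {m n : ℕ} {μ : Measure D} [SigmaFinite μ]
    {f : D → Matrix (Fin m) (Fin m) ℝ}
    (hf : ∀ i j, Measurable fun x => f x i j) {N : ℕ} {c q z η : ℝ} (hq : 0 ≤ q)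
    (hz : 0 < z)
    (hE : ∫⁻ X, ENNReal.ofReal (((c • 1 + ∑ j, f (X j)) ^ N).trace)
        ∂(Measure.pi fun _ : Fin n => μ) ≤
      ENNReal.ofReal q ^ n * ENNReal.ofReal (((c • (1 : Matrix (Fin m) (Fin m) ℝ)) ^ N).trace))
    (hnum : q ^ n * (m * c ^ N) ≤ η * z ^ N) :
    (Measure.pi fun _ : Fin n => μ) {X | z ^ N ≤ ((c • 1 + ∑ j, f (X j)) ^ N).trace} ≤
      ENNReal.ofReal η := by
  have hzN : 0 < z ^ N := pow_pos hz N
  have hmeas := (measurable_trace_add_sum_pow hf N n (c • 1)).ennreal_ofReal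
  have hset : {X : Fin n → D | z ^ N ≤ ((c • 1 + ∑ j, f (X j)) ^ N).trace} ⊆
      {X | ENNReal.ofReal (z ^ N) ≤ ENNReal.ofReal (((c • 1 + ∑ j, f (X j)) ^ N).trace)} :=
    fun X hX => ENNReal.ofReal_le_ofReal hX
  refine (measure_mono hset).trans ?_
  have hmk := mul_meas_ge_le_lintegral (μ := Measure.pi fun _ : Fin n => μ) hmeas
    (ENNReal.ofReal (z ^ N))
  have htr : ((c • (1 : Matrix (Fin m) (Fin m) ℝ)) ^ N).trace = m * c ^ N := by
    rw [smul_pow, one_pow, trace_smul, trace_one]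
    simp [mul_comm]
  rw [htr, ← ENNReal.ofReal_pow hq, ← ENNReal.ofReal_mul (pow_nonneg hq n)] at hE
  have h := (hmk.trans hE).trans (ENNReal.ofReal_le_ofReal hnum)
  rw [mul_comm η, ENNReal.ofReal_mul hzN.le] at h
  exact (ENNReal.mul_le_mul_iff_right (by simpa using hzN) ENNReal.ofReal_ne_top).1 h

lemma isHermitian_vecMulVec_self_s2 {ι : Type*} (w : ι → ℝ) : (vecMulVec w w).IsHermitian := by
  ext i j
  simp [vecMulVec_apply, mul_comm]

lemma isHermitian_smul_one {ι : Type*} [DecidableEq ι] (c : ℝ) :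
    (c • (1 : Matrix ι ι ℝ)).IsHermitian := by
  ext i j
  simp [one_apply, eq_comm]

/-- The quadratic form of a rank one matrix is bounded by Cauchy-Schwarz. -/
lemma quadForm_vecMulVec_self_le {ι : Type*} [Fintype ι] {w : ι → ℝ} {K : ℝ} (hw : w ⬝ᵥ w ≤ K)
    (x : ι → ℝ) : x ⬝ᵥ vecMulVec w w *ᵥ x ≤ K * (x ⬝ᵥ x) := by
  have h : x ⬝ᵥ vecMulVec w w *ᵥ x = (∑ i, w i * x i) ^ 2 := by
    rw [vecMulVec_mulVec, dotProduct_smul, dotProduct_comm x w]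
    simp [dotProduct, sq]
  rw [h]
  refine (Finset.sum_mul_sq_le_sq_mul_sq Finset.univ w x).trans ?_
  simp only [dotProduct, ← sq] at hw ⊢
  exact mul_le_mul_of_nonneg_right hw (Finset.sum_nonneg fun i _ => sq_nonneg _)

/-- The iterated trace bound for the upper tail. -/
lemma lintegral_trace_add_sum_pow_le {m n : ℕ} {μ : Measure D} [IsProbabilityMeasure μ]
    {v : D → Fin m → ℝ} (hv : ∀ k, Measurable fun x => v x k)
    (horth : ∀ k l, ∫ x, v x k * v x l ∂μ = if k = l then 1 else 0)
    {K : ℝ} (hK : ∀ x, v x ⬝ᵥ v x ≤ K)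
    {c r : ℝ} (hc : 0 < c) {p : ℕ} (hr : p * (K / c) ≤ r)
    (hr1 : r < 1) :
    ∫⁻ X, ENNReal.ofReal (((c • 1 + ∑ j, vecMulVec (v (X j)) (v (X j))) ^ (p + 1)).trace)
        ∂(Measure.pi fun _ : Fin n => μ) ≤
      ENNReal.ofReal (1 + (p + 1) / (1 - r) / c) ^ n *
        ENNReal.ofReal (((c • (1 : Matrix (Fin m) (Fin m) ℝ)) ^ (p + 1)).trace) := by
  refine lintegral_add_sum_le μ (fun x => vecMulVec (v x) (v x))
    (fun M : Matrix (Fin m) (Fin m) ℝ => ENNReal.ofReal ((M ^ (p + 1)).trace))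
    (fun _ B => B.IsHermitian ∧ ∀ x, c * (x ⬝ᵥ x) ≤ x ⬝ᵥ B *ᵥ x) _ (fun n B => ?_) ?_ ?_ n _ ?_
  · exact (measurable_trace_add_sum_pow (f := fun x => vecMulVec (v x) (v x))
      (fun i j => by simp only [vecMulVec_apply]; exact (hv i).mul (hv j)) _ n B).ennreal_ofReal
  · rintro - B x ⟨hB, hcB⟩
    exact ⟨hB.add (isHermitian_vecMulVec_self_s2 _), quadForm_rankOne_update rfl hcB⟩
  · rintro - B ⟨hB, hcB⟩
    have hκ : 0 ≤ (p + 1) / (1 - r) := div_nonneg (by positivity) (by linarith)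
    refine (lintegral_ofReal_le_of_le_quadForm μ hv horth hK
      (fun x => trace_pow_nonneg (hB.add (isHermitian_vecMulVec_self_s2 _)) hc.le
        (quadForm_rankOne_update rfl hcB) _)
      fun x => trace_pow_rankOne_update_le (hB.add (isHermitian_vecMulVec_self_s2 _)) hB rfl hc hcB
        (hK x) p hr hr1).trans ?_
    rw [← ENNReal.ofReal_mul (by positivity)]
    refine ENNReal.ofReal_le_ofReal ?_
    have h := mul_le_mul_of_nonneg_left (mul_trace_pow_le hB hc.le hcB p) (div_nonneg hκ hc.le)
    rw [← mul_assoc, div_mul_cancel₀ _ hc.ne'] at h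
    linarith
  · exact ⟨isHermitian_smul_one c, fun x => by simp [smul_mulVec]⟩

/-- The iterated trace bound for the lower tail. -/
lemma lintegral_trace_sub_sum_pow_le {m n : ℕ} {μ : Measure D} [IsProbabilityMeasure μ]
    {v : D → Fin m → ℝ} (hv : ∀ k, Measurable fun x => v x k)
    (horth : ∀ k l, ∫ x, v x k * v x l ∂μ = if k = l then 1 else 0)
    {K : ℝ} (hK : ∀ x, v x ⬝ᵥ v x ≤ K)
    {c c' r : ℝ} (hc' : 0 < c') (hK0 : 0 ≤ K)
    (hcc : c' + n * K ≤ c) {p : ℕ}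
    (hr : p * (K / c') ≤ r) (hr1 : r ≤ 1) (hq : 0 ≤ 1 - (p + 1) * (1 - r) / c) :
    ∫⁻ X, ENNReal.ofReal (((c • 1 + ∑ j, -vecMulVec (v (X j)) (v (X j))) ^ (p + 1)).trace)
        ∂(Measure.pi fun _ : Fin n => μ) ≤
      ENNReal.ofReal (1 - (p + 1) * (1 - r) / c) ^ n *
        ENNReal.ofReal (((c • (1 : Matrix (Fin m) (Fin m) ℝ)) ^ (p + 1)).trace) := by
  have hc : 0 < c := lt_of_lt_of_le (by positivity) hcc
  have hsub : ∀ (j : ℕ) (B : Matrix (Fin m) (Fin m) ℝ) (x : D),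
      (∀ y, (c' + (j + 1 : ℕ) * K) * (y ⬝ᵥ y) ≤ y ⬝ᵥ B *ᵥ y) → ∀ y,
        (c' + j * K) * (y ⬝ᵥ y) ≤ y ⬝ᵥ (B + -vecMulVec (v x) (v x)) *ᵥ y := by
    intro j B x hcB y
    have h1 := hcB y
    have h2 := quadForm_vecMulVec_self_le (hK x) y
    rw [add_mulVec, neg_mulVec, dotProduct_add, dotProduct_neg]
    push_cast at h1
    linarith
  have hweak : ∀ (j : ℕ) (B : Matrix (Fin m) (Fin m) ℝ),
      (∀ y, (c' + j * K) * (y ⬝ᵥ y) ≤ y ⬝ᵥ B *ᵥ y) → ∀ y, c' * (y ⬝ᵥ y) ≤ y ⬝ᵥ B *ᵥ y := by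
    intro j B hcB y
    refine le_trans ?_ (hcB y)
    have : 0 ≤ y ⬝ᵥ y := Finset.sum_nonneg fun i _ => mul_self_nonneg (y i)
    exact mul_le_mul_of_nonneg_right (le_add_of_nonneg_right (by positivity)) this
  refine lintegral_add_sum_le μ (fun x => -vecMulVec (v x) (v x))
    (fun M : Matrix (Fin m) (Fin m) ℝ => ENNReal.ofReal ((M ^ (p + 1)).trace))
    (fun j B => B.IsHermitian ∧ (∀ x, (c' + j * K) * (x ⬝ᵥ x) ≤ x ⬝ᵥ B *ᵥ x) ∧
      ∀ x, x ⬝ᵥ B *ᵥ x ≤ c * (x ⬝ᵥ x)) _ (fun n B => ?_) ?_ ?_ n _ ?_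
  · exact (measurable_trace_add_sum_pow (f := fun x => -vecMulVec (v x) (v x))
      (fun i j => by
        simp only [Matrix.neg_apply, vecMulVec_apply]
        exact ((hv i).mul (hv j)).neg) _ n B).ennreal_ofReal
  · rintro j B x ⟨hB, hcB, hBc⟩
    refine ⟨hB.add (isHermitian_vecMulVec_self_s2 _).neg, hsub j B x hcB, fun y => ?_⟩
    refine le_trans ?_ (hBc y)
    have := quadForm_rankOne_update (A := vecMulVec (v x) (v x)) (B := 0) (c := 0) (zero_add _).symm
      (by simp) y
    rw [add_mulVec, neg_mulVec, dotProduct_add, dotProduct_neg]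
    linarith
  · rintro j B ⟨hB, hcB, hBc⟩
    have hκ : 0 ≤ (p + 1) * (1 - r) := mul_nonneg (by positivity) (by linarith)
    have hherm : ∀ x, (B + -vecMulVec (v x) (v x)).IsHermitian := fun x =>
      hB.add (isHermitian_vecMulVec_self_s2 _).neg
    have hlow : ∀ x y, c' * (y ⬝ᵥ y) ≤ y ⬝ᵥ (B + -vecMulVec (v x) (v x)) *ᵥ y := fun x =>
      hweak j _ (hsub j B x hcB)
    refine (lintegral_ofReal_le_of_le_quadForm μ hv horth hK
      (fun x => trace_pow_nonneg (hherm x) hc'.le (hlow x) _)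
      fun x => trace_pow_rankOne_downdate_le hB (hherm x) (by abel) hc' (hlow x)
        (hK x) p hr).trans ?_
    rw [← ENNReal.ofReal_mul hq]
    refine ENNReal.ofReal_le_ofReal ?_
    have h := mul_le_mul_of_nonneg_left (trace_pow_le_mul hB hc'.le (hweak _ B hcB) hBc p)
      (div_nonneg hκ hc.le)
    rw [← mul_assoc, div_mul_cancel₀ _ hc.ne'] at h
    linarith
  · refine ⟨isHermitian_smul_one c, fun x => ?_, fun x => by simp [smul_mulVec]⟩
    have : 0 ≤ x ⬝ᵥ x := Finset.sum_nonneg fun i _ => mul_self_nonneg (x i)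
    simpa [smul_mulVec] using mul_le_mul_of_nonneg_right hcc this

end Sampling

lemma specNorm_le_of_abs_quadForm_le {m : ℕ} {A : Matrix (Fin m) (Fin m) ℝ} (hA : A.IsHermitian)
    {ε : ℝ} (hε : 0 ≤ ε) (h : ∀ x, |x ⬝ᵥ A *ᵥ x| ≤ ε * (x ⬝ᵥ x)) : specNorm A ≤ ε := by
  have hsymm : (LinearMap.toContinuousLinearMap (Matrix.toEuclideanLin A)).IsSymmetric :=
    isSymmetric_toEuclideanLin_iff.2 hA
  rw [specNorm, ContinuousLinearMap.norm_eq_iSup_rayleighQuotient _ hsymm]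
  refine Real.iSup_le (fun x => ?_) hε
  rw [ContinuousLinearMap.rayleighQuotient, ContinuousLinearMap.reApplyInnerSelf_apply, abs_div,
    abs_sq]
  refine div_le_of_le_mul₀ (sq_nonneg _) hε ?_
  have h1 := h x.ofLp
  rw [EuclideanSpace.real_norm_sq_eq]
  simp only [LinearMap.coe_toContinuousLinearMap', RCLike.re_to_real]
  rw [EuclideanSpace.inner_eq_star_dotProduct]
  simpa [dotProduct, sq] using h1

lemma pow_mul_le_of_mul_pow_ten_le {n N : ℕ} {q c z e η m : ℝ} (hN : N = 10 * n) (hq : 0 ≤ q)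
    (hc : 0 ≤ c) (hz : 0 ≤ z) (hm : 0 ≤ m) (h : q * c ^ 10 ≤ e * z ^ 10) (hη : m * e ^ n ≤ η) :
    q ^ n * (m * c ^ N) ≤ η * z ^ N := by
  have h1 : (q * c ^ 10) ^ n ≤ (e * z ^ 10) ^ n := pow_le_pow_left₀ (by positivity) h n
  rw [mul_pow, mul_pow, ← pow_mul, ← pow_mul, ← hN] at h1
  calc q ^ n * (m * c ^ N) = m * (q ^ n * c ^ N) := by ring
    _ ≤ m * (e ^ n * z ^ N) := mul_le_mul_of_nonneg_left h1 hm
    _ = (m * e ^ n) * z ^ N := by ring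
    _ ≤ η * z ^ N := mul_le_mul_of_nonneg_right hη (pow_nonneg hz N)

lemma mul_exp_neg_pow_le {δ : ℝ} (hδ0 : 0 < δ) (hδ1 : δ < 1) {n m : ℕ} (hn : 1 ≤ n) (hm1 : 1 ≤ m)
    (hm : (m : ℤ) = ⌊(n : ℝ) / (48 * (Real.sqrt 2 * Real.log (2 * n) - Real.log δ))⌋) :
    m * Real.exp (-(1 / (48 * m))) ^ n ≤ δ / 2 := by
  have hn' : (1 : ℝ) ≤ n := by exact_mod_cast hn
  have hm' : (1 : ℝ) ≤ m := by exact_mod_cast hm1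
  set L := Real.sqrt 2 * Real.log (2 * n) - Real.log δ with hL
  have hlogδ : Real.log δ < 0 := Real.log_neg hδ0 hδ1
  have hlog : Real.log 2 ≤ Real.log (2 * n) := Real.log_le_log (by norm_num) (by linarith)
  have hlog2 := Real.log_two_gt_d9
  have hsqrt : 1 ≤ Real.sqrt 2 := by
    rw [Real.one_le_sqrt]; norm_num
  have hL1 : Real.log (2 * n) - Real.log δ ≤ L := by nlinarith
  have hL2 : 0.69 ≤ L := by linarith
  have hfl : (m : ℝ) ≤ n / (48 * L) := by
    have := Int.floor_le ((n : ℝ) / (48 * L))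
    rw [← hm] at this
    exact_mod_cast this
  rw [le_div_iff₀ (by positivity)] at hfl
  have hmn : (m : ℝ) ≤ n := by nlinarith
  have hexp : Real.exp (-(1 / (48 * m))) ^ n ≤ δ / (2 * n) := by
    rw [← Real.exp_nat_mul, ← Real.le_log_iff_exp_le (by positivity),
      Real.log_div hδ0.ne' (by positivity)]
    have : L ≤ n * (1 / (48 * m)) := by
      rw [mul_one_div, le_div_iff₀ (by positivity)]
      linarith
    linarith
  calc _ ≤ m * (δ / (2 * n)) := by gcongr
    _ = (m / n) * (δ / 2) := by ring
    _ ≤ 1 * (δ / 2) := by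
      gcongr
      rwa [div_le_one (by positivity)]
    _ = _ := one_mul _

lemma upper_rate_le {c K : ℝ} (hc : 0 < c) (hK : 1 ≤ K) :
    (1 + 1 / (9 * K)) * c ^ 10 ≤
      Real.exp (-(1 / (48 * K))) * (c * (1 + 3 / (200 * K))) ^ 10 := by
  obtain ⟨t, ht⟩ : ∃ t, t = 1 / K := ⟨_, rfl⟩
  have ht0 : 0 < t := by rw [ht]; positivity
  have ht1 : t ≤ 1 := by rw [ht, div_le_one (by positivity)]; exact hK
  have e1 : 1 / (9 * K) = t / 9 := by rw [ht]; field_simp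
  have e2 : 1 / (48 * K) = t / 48 := by rw [ht]; field_simp
  have e3 : 3 / (200 * K) = 3 / 200 * t := by rw [ht]; field_simp
  rw [e1, e2, e3, mul_pow, mul_comm (c ^ 10), ← mul_assoc]
  refine mul_le_mul_of_nonneg_right ?_ (by positivity)
  have h1 : 1 - t / 48 ≤ Real.exp (-(t / 48)) := by linarith [Real.add_one_le_exp (-(t / 48))]
  have h2 : 1 + (10 : ℕ) * (3 / 200 * t) ≤ (1 + 3 / 200 * t) ^ 10 :=
    one_add_mul_le_pow (by linarith) 10
  push_cast at h2
  calc 1 + t / 9 ≤ (1 - t / 48) * (1 + 10 * (3 / 200 * t)) := by nlinarith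
    _ ≤ _ := mul_le_mul h1 h2 (by positivity) (Real.exp_pos _).le

lemma lower_rate_le {c K : ℝ} (hc : 0 < c) (hK : 1 ≤ K) :
    (1 - 89 / (990 * K)) * c ^ 10 ≤
      Real.exp (-(1 / (48 * K))) * (c * (1 - 1 / (200 * K))) ^ 10 := by
  obtain ⟨t, ht⟩ : ∃ t, t = 1 / K := ⟨_, rfl⟩
  have ht0 : 0 < t := by rw [ht]; positivity
  have ht1 : t ≤ 1 := by rw [ht, div_le_one (by positivity)]; exact hK
  have e1 : 89 / (990 * K) = 89 / 990 * t := by rw [ht]; field_simp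
  have e2 : 1 / (48 * K) = t / 48 := by rw [ht]; field_simp
  have e3 : 1 / (200 * K) = t / 200 := by rw [ht]; field_simp
  rw [e1, e2, e3, mul_pow, mul_comm (c ^ 10), ← mul_assoc]
  refine mul_le_mul_of_nonneg_right ?_ (by positivity)
  have h1 : 1 - t / 48 ≤ Real.exp (-(t / 48)) := by linarith [Real.add_one_le_exp (-(t / 48))]
  have h2 : 1 + (10 : ℕ) * (-(t / 200)) ≤ (1 + -(t / 200)) ^ 10 :=
    one_add_mul_le_pow (by linarith) 10
  push_cast at h2
  rw [← sub_eq_add_neg] at h2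
  calc 1 - 89 / 990 * t ≤ (1 - t / 48) * (1 + 10 * (-(t / 200))) := by nlinarith
    _ ≤ _ := mul_le_mul h1 h2 (by linarith) (Real.exp_pos _).le

lemma quadForm_add_sum {m n : ℕ} (c : ℝ) (f : Fin n → Matrix (Fin m) (Fin m) ℝ) (x : Fin m → ℝ) :
    x ⬝ᵥ (c • 1 + ∑ j, f j) *ᵥ x = c * (x ⬝ᵥ x) + x ⬝ᵥ (∑ j, f j) *ᵥ x := by
  simp [add_mulVec, smul_mulVec]

lemma isHermitian_sum {ι κ : Type*} [Fintype κ] {f : κ → Matrix ι ι ℝ}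
    (hf : ∀ j, (f j).IsHermitian) : (∑ j, f j).IsHermitian := by
  rw [IsHermitian, conjTranspose_sum]
  exact Finset.sum_congr rfl fun j _ => hf j

/-- if `m = ⌊n / (48(√2 ln(2n) - ln δ))⌋`, then with probability at least
`1 - δ` (for i.i.d. sampling) the empirical Gram matrix satisfies `‖H(X) - I‖ ≤ 1/2`. -/
theorem stmt2 {D : Type*} [MeasurableSpace D] (μ : Measure D) [IsProbabilityMeasure μ]
    (δ : ℝ) (hδ0 : 0 < δ) (hδ1 : δ < 1)
    (n m : ℕ) (hn : 1 ≤ n) (hm1 : 1 ≤ m)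
    (hm : (m : ℤ) = ⌊(n : ℝ) / (48 * (Real.sqrt 2 * Real.log (2 * n) - Real.log δ))⌋)
    (u : Fin m → D → ℝ) (humeas : ∀ k, Measurable (u k))
    (horth : ∀ k l : Fin m, ∫ x, u k x * u l x ∂μ = if k = l then 1 else 0)
    (hbound : ∀ x : D, ∑ k : Fin m, (u k x) ^ 2 ≤ (m : ℝ)) :
    ENNReal.ofReal (1 - δ) ≤
      (Measure.pi fun _ : Fin n => μ)
        {X : Fin n → D |
          specNorm
              ((1 / (n : ℝ)) •
                  ((Matrix.of fun (j : Fin n) (k : Fin m) => u k (X j))ᵀ *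
                    Matrix.of fun (j : Fin n) (k : Fin m) => u k (X j)) - 1) ≤ 1 / 2} := by
  have hn' : (1 : ℝ) ≤ n := by exact_mod_cast hn
  have hm' : (1 : ℝ) ≤ m := by exact_mod_cast hm1
  have hn0 : (0 : ℝ) < n := by linarith
  have hm0 : (0 : ℝ) < m := by linarith
  have hη := mul_exp_neg_pow_le hδ0 hδ1 hn hm1 hm
  set v : D → Fin m → ℝ := fun x k => u k x with hv
  have hK : ∀ x, v x ⬝ᵥ v x ≤ m := fun x => by
    simpa [dotProduct, hv, sq] using hbound x
  obtain ⟨p, hp⟩ : ∃ p, p + 1 = 10 * n := ⟨10 * n - 1, by omega⟩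
  have hp' : (p : ℝ) + 1 = 10 * n := by exact_mod_cast hp
  obtain ⟨c, hc⟩ : ∃ c : ℝ, c = 100 * n * m := ⟨_, rfl⟩
  have hc0 : 0 < c := by rw [hc]; positivity
  have hvm : ∀ i j, Measurable fun x => vecMulVec (v x) (v x) i j := fun i j => by
    simp only [vecMulVec_apply]
    exact (humeas i).mul (humeas j)
  have hz1 : c * (1 + 3 / (200 * m)) = c + 3 / 2 * n := by rw [hc]; field_simp; ring
  have hz2 : c * (1 - 1 / (200 * m)) = c - n / 2 := by rw [hc]; field_simp; ring
  have hz_pos : 0 < c - n / 2 := by rw [hc]; nlinarith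
  set bad1 : Set (Fin n → D) := {X | (c + 3 / 2 * n) ^ (p + 1) ≤
    ((c • 1 + ∑ j, vecMulVec (v (X j)) (v (X j))) ^ (p + 1)).trace} with hbad1
  set bad2 : Set (Fin n → D) := {X | (c - n / 2) ^ (p + 1) ≤
    ((c • 1 + ∑ j, -vecMulVec (v (X j)) (v (X j))) ^ (p + 1)).trace} with hbad2
  have hP1 : (Measure.pi fun _ : Fin n => μ) bad1 ≤ ENNReal.ofReal (δ / 2) := by
    have hE := lintegral_trace_add_sum_pow_le (n := n) (μ := μ) (v := v) humeas horth hK hc0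
      (p := p) (r := 1 / 10) (by
        rw [mul_div_assoc', div_le_iff₀ hc0, hc]
        nlinarith) (by norm_num)
    have hq : 1 + ((p : ℝ) + 1) / (1 - 1 / 10) / c = 1 + 1 / (9 * m) := by
      rw [hp', hc]; field_simp; norm_num; ring
    rw [hq] at hE
    refine measure_le_trace_pow_le hvm (by positivity) (by positivity) hE ?_
    refine pow_mul_le_of_mul_pow_ten_le hp (by positivity) hc0.le (by positivity) hm0.le ?_ hη
    rw [← hz1]
    exact upper_rate_le hc0 hm'
  have hP2 : (Measure.pi fun _ : Fin n => μ) bad2 ≤ ENNReal.ofReal (δ / 2) := by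
    have hq : 1 - ((p : ℝ) + 1) * (1 - 10 / 99) / c = 1 - 89 / (990 * m) := by
      rw [hp', hc]; field_simp; norm_num; ring
    have hq0 : 0 ≤ 1 - 89 / (990 * (m : ℝ)) := by
      rw [sub_nonneg, div_le_one (by positivity)]
      linarith
    have hE := lintegral_trace_sub_sum_pow_le (n := n) (μ := μ) (v := v) humeas horth hK (c := c)
      (c' := 99 * n * m) (by positivity) hm0.le (by rw [hc]; linarith)
      (p := p) (r := 10 / 99) (by
        rw [mul_div_assoc', div_le_iff₀ (by positivity)]
        nlinarith) (by norm_num) (hq ▸ hq0)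
    rw [hq] at hE
    refine measure_le_trace_pow_le (f := fun x => -vecMulVec (v x) (v x))
      (fun i j => (hvm i j).neg) hq0 hz_pos hE ?_
    refine pow_mul_le_of_mul_pow_ten_le hp hq0 hc0.le hz_pos.le hm0.le ?_ hη
    rw [← hz2]
    exact lower_rate_le hc0 hm'
  have hmeas : MeasurableSet (bad1 ∪ bad2) := by
    refine (measurableSet_le measurable_const (measurable_trace_add_sum_pow hvm _ _ _)).union
      (measurableSet_le measurable_const ?_)
    exact measurable_trace_add_sum_pow (f := fun x => -vecMulVec (v x) (v x))
      (fun i j => (hvm i j).neg) _ _ _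
  have hbad : (Measure.pi fun _ : Fin n => μ) (bad1 ∪ bad2) ≤ ENNReal.ofReal δ := by
    refine (measure_union_le _ _).trans ((add_le_add hP1 hP2).trans_eq ?_)
    rw [← ENNReal.ofReal_add (by positivity) (by positivity), add_halves]
  calc ENNReal.ofReal (1 - δ) = 1 - ENNReal.ofReal δ := by
        rw [ENNReal.ofReal_sub _ hδ0.le, ENNReal.ofReal_one]
    _ ≤ 1 - (Measure.pi fun _ : Fin n => μ) (bad1 ∪ bad2) := tsub_le_tsub_left hbad 1
    _ = (Measure.pi fun _ : Fin n => μ) (bad1 ∪ bad2)ᶜ := (prob_compl_eq_one_sub hmeas).symm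
    _ ≤ _ := measure_mono fun X hX => ?_
  simp only [hbad1, hbad2, Set.mem_compl_iff, Set.mem_union, Set.mem_ofPred_eq, not_or, not_le] at hX
  obtain ⟨hX1, hX2⟩ := hX
  have hgram : (Matrix.of fun (j : Fin n) (k : Fin m) => u k (X j))ᵀ *
      (Matrix.of fun (j : Fin n) (k : Fin m) => u k (X j)) =
        ∑ j, vecMulVec (v (X j)) (v (X j)) := by
    ext k l
    simp [mul_apply, Matrix.sum_apply, vecMulVec_apply, hv]
  have hquad0 : ∀ (j : Fin n) x, 0 ≤ x ⬝ᵥ vecMulVec (v (X j)) (v (X j)) *ᵥ x := fun j x => by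
    simpa using quadForm_rankOne_update (A := vecMulVec (v (X j)) (v (X j))) (B := 0) (c := 0)
      (zero_add _).symm (by simp) x
  have hsumq : ∀ (f : Fin n → Matrix (Fin m) (Fin m) ℝ) x,
      x ⬝ᵥ (∑ j, f j) *ᵥ x = ∑ j, x ⬝ᵥ f j *ᵥ x := fun f x => by
    rw [sum_mulVec, dotProduct_sum]
  have hxx : ∀ x : Fin m → ℝ, 0 ≤ x ⬝ᵥ x := fun x =>
    Finset.sum_nonneg fun i _ => mul_self_nonneg (x i)
  have hS0 : ∀ x, 0 ≤ x ⬝ᵥ (∑ j, vecMulVec (v (X j)) (v (X j))) *ᵥ x := fun x => by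
    rw [hsumq]
    exact Finset.sum_nonneg fun j _ => hquad0 j x
  have hS1 : ∀ x, x ⬝ᵥ (∑ j, vecMulVec (v (X j)) (v (X j))) *ᵥ x ≤ n * m * (x ⬝ᵥ x) := fun x => by
    rw [hsumq]
    refine (Finset.sum_le_sum fun j _ => quadForm_vecMulVec_self_le (hK (X j)) x).trans_eq ?_
    simp [mul_assoc]
  have hneg : ∀ x, x ⬝ᵥ (∑ j, -vecMulVec (v (X j)) (v (X j))) *ᵥ x =
      -(x ⬝ᵥ (∑ j, vecMulVec (v (X j)) (v (X j))) *ᵥ x) := fun x => by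
    rw [Finset.sum_neg_distrib, neg_mulVec, dotProduct_neg]
  have hherm := isHermitian_sum fun j => isHermitian_vecMulVec_self_s2 (v (X j))
  have hup := quadForm_le_of_trace_pow_lt ((isHermitian_smul_one c).add hherm) (fun x => by
    rw [quadForm_add_sum]
    exact add_nonneg (mul_nonneg hc0.le (hxx x)) (hS0 x)) (p + 1) hX1 (by positivity)
  have hlow := quadForm_le_of_trace_pow_lt ((isHermitian_smul_one c).add
    (isHermitian_sum fun j => (isHermitian_vecMulVec_self_s2 (v (X j))).neg)) (fun x => by
      rw [quadForm_add_sum, hneg]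
      have h := hS1 x
      have : (n : ℝ) * m * (x ⬝ᵥ x) ≤ c * (x ⬝ᵥ x) :=
        mul_le_mul_of_nonneg_right (by rw [hc]; nlinarith) (hxx x)
      linarith) (p + 1) hX2 hz_pos.le
  rw [Set.mem_ofPred_eq, hgram]
  refine specNorm_le_of_abs_quadForm_le ?_ (by norm_num) fun x => ?_
  · refine IsHermitian.sub ?_ isHermitian_one
    rw [IsHermitian, conjTranspose_smul, hherm.eq, star_trivial]
  · have h1 := hup x
    have h2 := hlow x
    rw [quadForm_add_sum] at h1 h2
    rw [hneg] at h2
    rw [sub_mulVec, smul_mulVec, one_mulVec, dotProduct_sub, dotProduct_smul, smul_eq_mul,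
      one_div_mul_eq_div, abs_le]
    constructor
    · rw [le_sub_iff_add_le, le_div_iff₀ hn0]
      linarith
    · rw [sub_le_iff_le_add, div_le_iff₀ hn0]
      linarith
end

section
/- Let m, n ≥ 1 be integers. Let g : D → ℝ be a measurable function whose L²-class lies in G and which satisfies ⟨g, η_k⟩_G = 0 for all 1 ≤ k ≤ m, and set g̃(x) = g(x)/√h_m(x) if h_m(x) > 0 and g̃(x) = 0 otherwise. Then ∫_{Dⁿ} Σ_{k=1}^m ( Σ_{j=1}^n η̃_k(x^j)·g̃(x^j) )² dμ_m^{⊗n}(X) ≤ n·m·‖g‖²_G. -/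
open MeasureTheory

noncomputable section

/-- The measure `ρ(x) dx` on `D ⊆ ℝ^d`, underlying the space `G = L²(D, ρ(x) dx)`. -/
def Gmeasure (d : ℕ) (D : Set (Fin d → ℝ)) (ρ : (Fin d → ℝ) → ℝ) : Measure (Fin d → ℝ) :=
  (volume.restrict D).withDensity fun x => ENNReal.ofReal (ρ x)

/-- The `G`-inner product `⟨f, g⟩_G = ∫ f·g dμ`. -/
def Ginner {α : Type*} [MeasurableSpace α] (μ : Measure α) (f g : α → ℝ) : ℝ :=
  ∫ x, f x * g x ∂μ

/-- Membership in the unit ball `B`: `f` is measurable, square integrable, its `L²`-class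
lies in the closed linear span of the orthonormal system `η` (expressed via Parseval's
identity), and `∑_k ⟨f, η_k⟩²/λ_k ≤ 1`.  Throughout, index `k : ℕ` stands for the paper's
index `k+1`, so `Λ k = λ_{k+1}` and `η k = η_{k+1}`. -/
def memB {α : Type*} [MeasurableSpace α] (μ : Measure α) (η : ℕ → α → ℝ) (Λ : ℕ → ℝ)
    (f : α → ℝ) : Prop :=
  Measurable f ∧ Integrable (fun x => f x ^ 2) μ ∧
    (∫ x, f x ^ 2 ∂μ) = ∑' k, (Ginner μ f (η k)) ^ 2 ∧
    ∑' k, (Ginner μ f (η k)) ^ 2 / Λ k ≤ 1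

/-- `h_m(x) = (1/m) ∑_{j=1}^m η_j(x)²`. -/
def hFun (m : ℕ) {α : Type*} (η : ℕ → α → ℝ) (x : α) : ℝ :=
  (1 / (m : ℝ)) * ∑ j ∈ Finset.range m, η j x ^ 2

/-- `f̃(x) = f(x)/√h(x)` where `h(x) > 0`, and `0` elsewhere. -/
def tilde {α : Type*} (h : α → ℝ) (f : α → ℝ) (x : α) : ℝ :=
  if 0 < h x then f x / Real.sqrt (h x) else 0

/-- The sampling measure `μ_m` with density `ω_m = h_m·ρ` on `D`. -/
def muM (d m : ℕ) (D : Set (Fin d → ℝ)) (ρ : (Fin d → ℝ) → ℝ) (η : ℕ → (Fin d → ℝ) → ℝ) :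
    Measure (Fin d → ℝ) :=
  (Gmeasure d D ρ).withDensity fun x => ENNReal.ofReal (hFun m η x)

/-- A randomized linear algorithm using `n` function values: a probability measure `ν` on
`Dⁿ` together with jointly measurable coefficient functions `g_j : Dⁿ → G`. -/
def IsRandLinAlg (d n : ℕ) (D : Set (Fin d → ℝ)) (ν : Measure (Fin n → Fin d → ℝ))
    (g : Fin n → (Fin n → Fin d → ℝ) → (Fin d → ℝ) → ℝ) : Prop :=
  IsProbabilityMeasure ν ∧ ν {X | ∀ j, X j ∈ D} = 1 ∧
    ∀ j, Measurable (Function.uncurry (g j))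

/-- The randomized error of the algorithm `A_X f = ∑_j f(x^j)·g_j(X)` is at most `c`:
for every `f ∈ B` one has `∫ ‖f - A_X f‖²_G dν(X) ≤ c²`. -/
def randErrLe (d n : ℕ) (μ : Measure (Fin d → ℝ)) (η : ℕ → (Fin d → ℝ) → ℝ) (Λ : ℕ → ℝ)
    (ν : Measure (Fin n → Fin d → ℝ)) (g : Fin n → (Fin n → Fin d → ℝ) → (Fin d → ℝ) → ℝ)
    (c : ℝ) : Prop :=
  ∀ f : (Fin d → ℝ) → ℝ, memB μ η Λ f →
    (∫⁻ X, ENNReal.ofReal (∫ x, (f x - ∑ j, f (X j) * g j X x) ^ 2 ∂μ) ∂ν)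
      ≤ ENNReal.ofReal (c ^ 2)

/-- For square integrable centred `F`, the cross terms of `(∑_j F(x^j))²` integrate to zero over
independent copies `x^j`. -/
theorem lintegral_sq_sum_pi {α : Type*} [MeasurableSpace α] (ν : Measure α)
    [IsProbabilityMeasure ν] (n : ℕ) {F : α → ℝ} (hF : MemLp F 2 ν) (hF0 : ∫ x, F x ∂ν = 0) :
    ∫⁻ X : Fin n → α, ENNReal.ofReal ((∑ j, F (X j)) ^ 2) ∂(Measure.pi fun _ => ν)
      = n * ∫⁻ x, ENNReal.ofReal (F x ^ 2) ∂ν := by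
  have hcoord (j : Fin n) : MemLp (fun X : Fin n → α => F (X j)) 2 (Measure.pi fun _ => ν) :=
    hF.comp_measurePreserving (measurePreserving_eval (fun _ => ν) j)
  have hsum : MemLp (fun X : Fin n → α => ∑ j, F (X j)) 2 (Measure.pi fun _ => ν) :=
    memLp_finsetSum _ fun j _ => hcoord j
  have hmean : ∫ X : Fin n → α, ∑ j, F (X j) ∂(Measure.pi fun _ => ν) = 0 := by
    rw [integral_finsetSum _ fun j _ => (hcoord j).integrable one_le_two]
    refine Finset.sum_eq_zero fun j _ => ?_
    rw [integral_comp_eval (μ := fun _ : Fin n => ν) hF.aestronglyMeasurable, hF0]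
  have hvar := ProbabilityTheory.variance_sum_pi (μ := fun _ : Fin n => ν) fun _ => hF
  rw [show (∑ j : Fin n, fun X : Fin n → α => F (X j)) = fun X => ∑ j, F (X j) by
      ext X; simp,
    ProbabilityTheory.variance_of_integral_eq_zero hsum.aestronglyMeasurable.aemeasurable hmean,
    ProbabilityTheory.variance_of_integral_eq_zero hF.aestronglyMeasurable.aemeasurable hF0,
    Finset.sum_const, Finset.card_univ, Fintype.card_fin, nsmul_eq_mul] at hvar
  rw [← ofReal_integral_eq_lintegral_ofReal hsum.integrable_sq (ae_of_all _ fun _ => sq_nonneg _),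
    ← ofReal_integral_eq_lintegral_ofReal hF.integrable_sq (ae_of_all _ fun _ => sq_nonneg _),
    hvar, ENNReal.ofReal_mul n.cast_nonneg, ENNReal.ofReal_natCast]

section PointwiseBounds

variable {α : Type*} {m : ℕ} (η : ℕ → α → ℝ) (g : α → ℝ) (x : α)

theorem hFun_nonneg : 0 ≤ hFun m η x := by
  unfold hFun
  positivity

theorem sq_le_mul_hFun {k : ℕ} (hk : k < m) : η k x ^ 2 ≤ m * hFun m η x := by
  have hm : (m : ℝ) ≠ 0 := by
    exact_mod_cast (Nat.zero_lt_of_lt hk).ne'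
  rw [hFun, ← mul_assoc, mul_one_div_cancel hm, one_mul]
  exact Finset.single_le_sum (f := fun j => η j x ^ 2) (fun _ _ => sq_nonneg _)
    (Finset.mem_range.2 hk)

theorem hFun_mul_tilde_mul_tilde {k : ℕ} (hk : k < m) :
    hFun m η x * (tilde (hFun m η) (η k) x * tilde (hFun m η) g x) = g x * η k x := by
  by_cases hx : 0 < hFun m η x
  · have hs : √(hFun m η x) ≠ 0 := (Real.sqrt_pos.2 hx).ne'
    simp only [tilde, hx, if_true]
    rw [div_mul_div_comm, Real.mul_self_sqrt hx.le]
    field_simp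
  · have h0 : hFun m η x = 0 := le_antisymm (not_lt.1 hx) (hFun_nonneg η x)
    have hη : η k x = 0 := by
      have := sq_le_mul_hFun η x hk
      rw [h0, mul_zero] at this
      exact pow_eq_zero_iff two_ne_zero |>.1 (le_antisymm this (sq_nonneg _))
    simp [h0, hη]

theorem sum_hFun_mul_sq_tilde_le (hm : 1 ≤ m) :
    ∑ k ∈ Finset.range m,
      hFun m η x * (tilde (hFun m η) (η k) x * tilde (hFun m η) g x) ^ 2 ≤ m * g x ^ 2 := by
  by_cases hx : 0 < hFun m η x
  · have hm0 : (m : ℝ) ≠ 0 := by exact_mod_cast (Nat.one_le_iff_ne_zero.1 hm)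
    have hsum : ∑ k ∈ Finset.range m, η k x ^ 2 = m * hFun m η x := by
      rw [hFun, ← mul_assoc, mul_one_div_cancel hm0, one_mul]
    have hterm (k : ℕ) : hFun m η x * (tilde (hFun m η) (η k) x * tilde (hFun m η) g x) ^ 2
        = η k x ^ 2 * (g x ^ 2 / hFun m η x) := by
      simp only [tilde, hx, if_true]
      rw [div_mul_div_comm, Real.mul_self_sqrt hx.le]
      field_simp
    simp only [hterm]
    rw [← Finset.sum_mul, hsum]
    exact le_of_eq (by field_simp)
  · simp only [tilde, hx, if_false]
    simp only [mul_zero, ne_eq, OfNat.ofNat_ne_zero, not_false_eq_true, zero_pow,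
      Finset.sum_const_zero]
    positivity

end PointwiseBounds

section Measurability

variable {α : Type*} [MeasurableSpace α]

theorem measurable_hFun {η : ℕ → α → ℝ} (hη : ∀ k, Measurable (η k)) (m : ℕ) :
    Measurable (hFun m η) := by
  unfold hFun
  fun_prop

theorem measurable_tilde {h f : α → ℝ} (hh : Measurable h) (hf : Measurable f) :
    Measurable (tilde h f) :=
  Measurable.ite (measurableSet_lt measurable_const hh) (hf.div hh.sqrt) measurable_const

end Measurability

theorem isProbabilityMeasure_withDensity_hFun {α : Type*} [MeasurableSpace α] {μ : Measure α}
    {η : ℕ → α → ℝ} (horth : ∀ k, Ginner μ (η k) (η k) = 1) {m : ℕ} (hm : 1 ≤ m) :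
    IsProbabilityMeasure (μ.withDensity fun x => ENNReal.ofReal (hFun m η x)) := by
  have hm0 : (m : ℝ) ≠ 0 := by exact_mod_cast (Nat.one_le_iff_ne_zero.1 hm)
  have horth' (k : ℕ) : ∫ x, η k x ^ 2 ∂μ = 1 := by
    simpa only [Ginner, ← sq] using horth k
  have hint (k : ℕ) : Integrable (fun x => η k x ^ 2) μ :=
    Integrable.of_integral_ne_zero (by rw [horth' k]; exact one_ne_zero)
  have hhint : Integrable (hFun m η) μ :=
    (integrable_finsetSum _ fun k _ => hint k).const_mul _
  refine ⟨?_⟩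
  rw [withDensity_apply _ MeasurableSet.univ, Measure.restrict_univ,
    ← ofReal_integral_eq_lintegral_ofReal hhint (ae_of_all _ (hFun_nonneg η))]
  simp only [hFun]
  rw [integral_const_mul, integral_finsetSum _ fun k _ => hint k]
  simp [horth', hm0]

/-- the key variance bound for the weighted least squares method:
for `g ⊥ η_1,…,η_m` in `G`,
`∫_{Dⁿ} ∑_{k=1}^m (∑_{j=1}^n η̃_k(x^j) g̃(x^j))² dμ_m^{⊗n}(X) ≤ n·m·‖g‖²_G`. -/
theorem stmt3 (d : ℕ) (D : Set (Fin d → ℝ)) (hD : MeasurableSet D) (hDpos : 0 < volume D)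
    (ρ : (Fin d → ℝ) → ℝ) (hρmeas : Measurable ρ) (hρnn : ∀ x ∈ D, 0 ≤ ρ x)
    (hρint : ∫ x in D, ρ x = 1)
    (Λ : ℕ → ℝ) (hΛpos : ∀ k, 0 < Λ k) (hΛanti : Antitone Λ)
    (η : ℕ → (Fin d → ℝ) → ℝ) (hηmeas : ∀ k, Measurable (η k))
    (horth : ∀ k l, Ginner (Gmeasure d D ρ) (η k) (η l) = if k = l then 1 else 0)
    (m n : ℕ) (hm : 1 ≤ m) (hn : 1 ≤ n)
    (g : (Fin d → ℝ) → ℝ) (hgmeas : Measurable g)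
    (hgL2 : Integrable (fun x => g x ^ 2) (Gmeasure d D ρ))
    (hgorth : ∀ k < m, Ginner (Gmeasure d D ρ) g (η k) = 0) :
    (∫⁻ X : Fin n → Fin d → ℝ,
        ENNReal.ofReal (∑ k ∈ Finset.range m,
          (∑ j, tilde (hFun m η) (η k) (X j) * tilde (hFun m η) g (X j)) ^ 2)
        ∂(Measure.pi fun _ : Fin n => muM d m D ρ η))
      ≤ ENNReal.ofReal ((n : ℝ) * m * ∫ x, g x ^ 2 ∂(Gmeasure d D ρ)) := by
  set μ := Gmeasure d D ρ with hμ
  set h := hFun m η with hh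
  set F : ℕ → (Fin d → ℝ) → ℝ := fun k x => tilde h (η k) x * tilde h g x with hF
  have hhmeas : Measurable h := measurable_hFun hηmeas m
  have hFmeas (k : ℕ) : Measurable (F k) :=
    (measurable_tilde hhmeas (hηmeas k)).mul (measurable_tilde hhmeas hgmeas)
  have hprob : IsProbabilityMeasure (muM d m D ρ η) :=
    isProbabilityMeasure_withDensity_hFun (fun k => (horth k k).trans (if_pos rfl)) hm
  have hmean (k : ℕ) (hk : k < m) : ∫ x, F k x ∂(muM d m D ρ η) = 0 := by
    rw [muM, integral_withDensity_eq_integral_toReal_smul hhmeas.ennreal_ofReal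
      (ae_of_all _ fun _ => ENNReal.ofReal_lt_top), ← hgorth k hk, Ginner]
    refine integral_congr_ae (ae_of_all _ fun x => ?_)
    have hx : (ENNReal.ofReal (h x)).toReal = h x := ENNReal.toReal_ofReal (hFun_nonneg η x)
    simp only [smul_eq_mul]
    rw [hx]
    exact hFun_mul_tilde_mul_tilde η g x hk
  have hsq (k : ℕ) : ∫⁻ x, ENNReal.ofReal (F k x ^ 2) ∂(muM d m D ρ η)
      = ∫⁻ x, ENNReal.ofReal (h x * F k x ^ 2) ∂μ := by
    rw [muM, lintegral_withDensity_eq_lintegral_mul _ hhmeas.ennreal_ofReal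
      ((hFmeas k).pow_const 2).ennreal_ofReal]
    refine lintegral_congr fun x => ?_
    rw [Pi.mul_apply, ← ENNReal.ofReal_mul (hFun_nonneg η x)]
  have hsum : ∑ k ∈ Finset.range m, ∫⁻ x, ENNReal.ofReal (F k x ^ 2) ∂(muM d m D ρ η)
      ≤ ENNReal.ofReal (m * ∫ x, g x ^ 2 ∂μ) := by
    simp only [hsq]
    rw [← lintegral_finsetSum _
        fun k _ => by fun_prop,
      ← integral_const_mul, ofReal_integral_eq_lintegral_ofReal (hgL2.const_mul _)
        (ae_of_all _ fun _ => by positivity)]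
    refine lintegral_mono fun x => ?_
    rw [← ENNReal.ofReal_sum_of_nonneg
      fun k _ => mul_nonneg (hFun_nonneg η x) (sq_nonneg _)]
    exact ENNReal.ofReal_le_ofReal (sum_hFun_mul_sq_tilde_le η g x hm)
  have hL2 (k : ℕ) (hk : k < m) : MemLp (F k) 2 (muM d m D ρ η) := by
    rw [memLp_two_iff_integrable_sq (hFmeas k).aestronglyMeasurable]
    refine ⟨((hFmeas k).pow_const 2).aestronglyMeasurable, ?_⟩
    rw [hasFiniteIntegral_iff_ofReal (ae_of_all _ fun _ => sq_nonneg _)]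
    exact (ENNReal.sum_lt_top.1 (hsum.trans_lt ENNReal.ofReal_lt_top)) k (Finset.mem_range.2 hk)
  calc ∫⁻ X : Fin n → Fin d → ℝ, ENNReal.ofReal (∑ k ∈ Finset.range m, (∑ j, F k (X j)) ^ 2)
        ∂(Measure.pi fun _ : Fin n => muM d m D ρ η)
      = ∑ k ∈ Finset.range m, ∫⁻ X : Fin n → Fin d → ℝ, ENNReal.ofReal ((∑ j, F k (X j)) ^ 2)
        ∂(Measure.pi fun _ : Fin n => muM d m D ρ η) := by
        rw [← lintegral_finsetSum _ fun k _ => by fun_prop]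
        refine lintegral_congr fun X => ?_
        rw [ENNReal.ofReal_sum_of_nonneg fun k _ => sq_nonneg _]
    _ = n * ∑ k ∈ Finset.range m, ∫⁻ x, ENNReal.ofReal (F k x ^ 2) ∂(muM d m D ρ η) := by
        rw [Finset.mul_sum]
        refine Finset.sum_congr rfl fun k hk => ?_
        rw [Finset.mem_range] at hk
        exact lintegral_sq_sum_pi _ n (hL2 k hk) (hmean k hk)
    _ ≤ n * ENNReal.ofReal (m * ∫ x, g x ^ 2 ∂μ) := by gcongr
    _ = ENNReal.ofReal ((n : ℝ) * m * ∫ x, g x ^ 2 ∂μ) := by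
        rw [mul_assoc, ENNReal.ofReal_mul n.cast_nonneg, ENNReal.ofReal_natCast]

end
end
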